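/- arXiv:math-ph/0601008 — 4 statements merged into one kernel-verified Lean document; each statement's English description precedes it below -/
import Mathlib

section
/- (Corollary 3.3: resolvent bound on the contour C₂ near the second nonresonance set.) Assume 0 < 7δ < 2l−11−16s₁ and η > 2 + 2/s₁, and set ε₁ = exp(−(1/4)·k^{η·s₁}). For sufficiently large k (depending only on l, δ, η, b₁, b₂, C_W) the following holds. Let τ₀ ∈ ℝ² be such that k^{2l} is an eigenvalue of H̃(τ₀) and every eigenvalue λ' of H̃(τ₀) with λ' ≠ k^{2l} satisfies |λ' − k^{2l}| > ε₁. Then for every τ ∈ ℂ² with |τ − τ₀| ≤ ε₁·k^{−2l+1−δ}, every z ∈ ℂ with |z − k^{2l}| = ε₁/2, and every g ∈ ℓ²(ℤ²;ℂ), there is a unique f ∈ ℓ²(ℤ²;ℂ) with |p̃_m(τ)|_*^{2l}·f_m + ∑_{q∈ℤ²} w̃_{m−q}·f_q − z·f_m = g_m for every m ∈ ℤ², and it satisfies ‖f‖_{ℓ²} ≤ (4/ε₁)·‖g‖_{ℓ²}. -/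
open Real Set

noncomputable section

/-- `s₁ = (2l-11)/32`. -/
def s1 (l : ℕ) : ℝ := (2 * (l : ℝ) - 11) / 32

/-- The dual-lattice point `p_m(0) = (2πm₁/a₁, 2πm₂/a₂)`. -/
def pvec (a₁ a₂ : ℝ) (m : ℤ × ℤ) : ℝ × ℝ := (2 * π * m.1 / a₁, 2 * π * m.2 / a₂)

/-- Squared Euclidean norm on `ℝ²`. -/
def sq2 (v : ℝ × ℝ) : ℝ := v.1 ^ 2 + v.2 ^ 2

/-- The bilinear square `|y|²_* = y₁² + y₂²` on `ℂ²` (no conjugation). -/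
def nsq (v : ℂ × ℂ) : ℂ := v.1 ^ 2 + v.2 ^ 2

/-- Complexification of a real vector. -/
def cx (x : ℝ × ℝ) : ℂ × ℂ := ((x.1 : ℂ), (x.2 : ℂ))

/-- Euclidean norm on `ℂ²`. -/
def cnorm (v : ℂ × ℂ) : ℝ := Real.sqrt (‖v.1‖ ^ 2 + ‖v.2‖ ^ 2)

/-- `γ₀ = 2l - 2 - 4s₁ - 2δ`. -/
def gam0 (l : ℕ) (δ : ℝ) : ℝ := 2 * (l : ℝ) - 2 - 4 * s1 l - 2 * δ

/-- A solution `f ∈ ℓ²(ℤ²)` of the eigenvalue equation with diagonal part `pw`,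
off-diagonal matrix `M` (acting by convolution) and spectral parameter `lam`;
the series involved are required to converge absolutely. -/
def IsSolution (pw : ℤ × ℤ → ℂ) (M : ℤ × ℤ → ℂ) (lam : ℂ) (f : ℤ × ℤ → ℂ) : Prop :=
  Memℓp f 2 ∧ (∀ m : ℤ × ℤ, Summable fun q : ℤ × ℤ => ‖M (m - q) * f q‖) ∧
    ∀ m : ℤ × ℤ, pw m * f m + ∑' q : ℤ × ℤ, M (m - q) * f q = lam * f m

/-- `lam` is an eigenvalue: there is a nonzero `ℓ²` solution. -/
def IsEigenvalue (pw : ℤ × ℤ → ℂ) (M : ℤ × ℤ → ℂ) (lam : ℂ) : Prop :=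
  ∃ f : ℤ × ℤ → ℂ, IsSolution pw M lam f ∧ f ≠ 0

/-- `lam` is a simple eigenvalue: the space of `ℓ²` solutions is one-dimensional. -/
def IsSimpleEigenvalue (pw : ℤ × ℤ → ℂ) (M : ℤ × ℤ → ℂ) (lam : ℂ) : Prop :=
  ∃ f : ℤ × ℤ → ℂ, IsSolution pw M lam f ∧ f ≠ 0 ∧
    ∀ g : ℤ × ℤ → ℂ, IsSolution pw M lam g → ∃ c : ℂ, g = c • f

/-- Fourier coefficients of a periodic function `W` on the cell `[0,a₁] × [0,a₂]`. -/
def fCoeff (a₁ a₂ : ℝ) (W : ℝ × ℝ → ℝ) (j : ℤ × ℤ) : ℂ :=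
  ((a₁ * a₂ : ℝ) : ℂ)⁻¹ *
    ∫ x in Icc (0 : ℝ × ℝ) (a₁, a₂),
      (W x : ℂ) *
        Complex.exp (-Complex.I * (((pvec a₁ a₂ j).1 * x.1 + (pvec a₁ a₂ j).2 * x.2 : ℝ) : ℂ))

/-- `ε₁ = exp(-(1/4) k^{η s₁})`. -/
def eps1 (l : ℕ) (η k : ℝ) : ℝ := Real.exp (-(1 / 4) * k ^ (η * s1 l))

/-- Shifted dual lattice points `p̃_m(τ)` for the enlarged periods `Na₁, Na₂`. -/
def ptil (N : ℕ) (a₁ a₂ : ℝ) (τ : ℝ × ℝ) (m : ℤ × ℤ) : ℝ × ℝ :=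
  (2 * π * m.1 / (N * a₁) + τ.1, 2 * π * m.2 / (N * a₂) + τ.2)

/-- Complex shifted dual lattice points `p̃_m(τ)`, `τ ∈ ℂ²`. -/
def ptilC (N : ℕ) (a₁ a₂ : ℝ) (τ : ℂ × ℂ) (m : ℤ × ℤ) : ℂ × ℂ :=
  (((2 * π * m.1 / (N * a₁) : ℝ) : ℂ) + τ.1, ((2 * π * m.2 / (N * a₂) : ℝ) : ℂ) + τ.2)

/-- The coefficients `w̃` of `W` viewed with the enlarged periods. -/
def wtil (N : ℕ) (w : ℤ × ℤ → ℂ) (m : ℤ × ℤ) : ℂ :=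
  if (N : ℤ) ∣ m.1 ∧ (N : ℤ) ∣ m.2 then w (m.1 / N, m.2 / N) else 0

/-- The multiplication operator by a bounded sequence on `ℓ²`. -/
def diagOp {ι : Type*} (c : ι → ℂ) {C : ℝ} (hC : 0 ≤ C) (hc : ∀ i, ‖c i‖ ≤ C) :
    lp (fun _ : ι => ℂ) 2 →L[ℂ] lp (fun _ : ι => ℂ) 2 :=
  lp.mapCLM 2 (fun i => c i • ContinuousLinearMap.id ℂ ℂ) hC (fun i => by
    simpa [norm_smul] using hc i)

theorem diagOp_apply {ι : Type*} (c : ι → ℂ) {C : ℝ} (hC : 0 ≤ C) (hc : ∀ i, ‖c i‖ ≤ C)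
    (f : lp (fun _ : ι => ℂ) 2) (i : ι) : diagOp c hC hc f i = c i * f i := rfl

theorem isSelfAdjoint_diagOp {ι : Type*} (c : ι → ℝ) {C : ℝ} (hC : 0 ≤ C)
    (hc : ∀ i, ‖(c i : ℂ)‖ ≤ C) : IsSelfAdjoint (diagOp (fun i => (c i : ℂ)) hC hc) := by
  rw [ContinuousLinearMap.isSelfAdjoint_iff_isSymmetric]
  intro f g
  simp only [ContinuousLinearMap.coe_coe, lp.inner_eq_tsum, diagOp_apply]
  refine tsum_congr fun i => ?_
  simp
  ring

theorem isCompactOperator_diagOp {ι : Type*} (c : ι → ℂ) {C : ℝ} (hC : 0 ≤ C)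
    (hc : ∀ i, ‖c i‖ ≤ C) (h0 : Filter.Tendsto c Filter.cofinite (nhds 0)) :
    IsCompactOperator (diagOp c hC hc) := by
  classical
  have hF : ∀ s : Finset ι, IsCompactOperator
      (∑ i ∈ s, (c i • lp.singleContinuousLinearMap ℂ (fun _ : ι => ℂ) 2 i).comp
        (lp.evalCLM ℂ (fun _ : ι => ℂ) 2 i) :
        lp (fun _ : ι => ℂ) 2 →L[ℂ] lp (fun _ : ι => ℂ) 2) := by
    intro s
    refine Finset.sum_induction _ (fun T : lp (fun _ : ι => ℂ) 2 →L[ℂ] lp (fun _ : ι => ℂ) 2 =>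
      IsCompactOperator T) (fun a b ha hb => ha.add hb) isCompactOperator_zero fun i _ => ?_
    have he : IsCompactOperator (lp.evalCLM ℂ (fun _ : ι => ℂ) 2 i) :=
      isCompactOperator_of_locallyCompactSpace_dom
        (lp.evalCLM ℂ (fun _ : ι => ℂ) 2 i : lp (fun _ : ι => ℂ) 2 →L[ℂ] ℂ)
    exact he.clm_comp (c i • lp.singleContinuousLinearMap ℂ (fun _ : ι => ℂ) 2 i)
  refine isCompactOperator_of_tendsto (l := Filter.atTop) ?_ (Filter.Eventually.of_forall hF)
  rw [Metric.tendsto_atTop]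
  intro ε hε
  have hfin : {i | ¬ ‖c i‖ < ε / 2}.Finite := by
    have := (tendsto_order.1 h0.norm).2 (ε / 2) (by simpa using half_pos hε)
    simpa [Filter.eventually_cofinite] using this
  refine ⟨hfin.toFinset, fun s hs => ?_⟩
  rw [dist_eq_norm]
  refine lt_of_le_of_lt (ContinuousLinearMap.opNorm_le_bound _ (half_pos hε).le fun f => ?_)
    (half_lt_self hε)
  have heval : ∀ j, lp.evalCLM ℂ (fun _ : ι => ℂ) 2 j f = f j := fun _ => rfl
  have hval : ∀ j, ((∑ i ∈ s, (c i • lp.singleContinuousLinearMap ℂ (fun _ : ι => ℂ) 2 i).comp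
        (lp.evalCLM ℂ (fun _ : ι => ℂ) 2 i)) - diagOp c hC hc) f j
        = if j ∈ s then 0 else - (c j * f j) := by
    intro j
    have : ((∑ i ∈ s, (c i • lp.singleContinuousLinearMap ℂ (fun _ : ι => ℂ) 2 i).comp
        (lp.evalCLM ℂ (fun _ : ι => ℂ) 2 i)) f : lp (fun _ : ι => ℂ) 2) j
        = ∑ i ∈ s, c i * (if j = i then f i else 0) := by
      rw [sum_apply, lp.coeFn_sum, Finset.sum_apply]
      refine Finset.sum_congr rfl fun i _ => ?_
      by_cases hji : j = i
      · subst hji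
        simp [heval]
      · simp [hji]
    rw [sub_apply, lp.coeFn_sub, Pi.sub_apply, this, diagOp_apply]
    simp
    split_ifs <;> simp
  have : ‖(((∑ i ∈ s, (c i • lp.singleContinuousLinearMap ℂ (fun _ : ι => ℂ) 2 i).comp
        (lp.evalCLM ℂ (fun _ : ι => ℂ) 2 i)) - diagOp c hC hc) f)‖
      ≤ ‖((ε / 2 : ℝ) : ℂ) • f‖ := by
    refine lp.norm_mono (by norm_num) fun j => ?_
    rw [hval]
    split_ifs with hj
    · rw [norm_zero]; positivity
    · have : ‖c j‖ < ε / 2 := by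
        by_contra hcon
        exact hj (hs (by simpa using hcon))
      rw [norm_neg, norm_mul, lp.coeFn_smul, Pi.smul_apply, norm_smul, Complex.norm_real,
        Real.norm_of_nonneg (half_pos hε).le]
      gcongr
  rwa [norm_smul, Complex.norm_real, Real.norm_of_nonneg (half_pos hε).le] at this

/-- The resolvent `(D + 1)⁻¹` of a nonnegative diagonal operator `D` on `ℓ²`. -/
def diagRes {ι : Type*} (d : ι → ℝ) (hd : ∀ i, 0 ≤ d i) :
    lp (fun _ : ι => ℂ) 2 →L[ℂ] lp (fun _ : ι => ℂ) 2 :=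
  diagOp (fun i => (((d i + 1)⁻¹ : ℝ) : ℂ)) zero_le_one (fun i => by
    have := hd i
    rw [Complex.norm_real, Real.norm_of_nonneg (by positivity)]
    exact inv_le_one_of_one_le₀ (by linarith))

theorem diagRes_apply {ι : Type*} (d : ι → ℝ) (hd : ∀ i, 0 ≤ d i)
    (f : lp (fun _ : ι => ℂ) 2) (i : ι) :
    ((d i : ℂ) + 1) * diagRes d hd f i = f i := by
  have h : ((d i : ℂ) + 1) ≠ 0 := by
    have := hd i
    exact_mod_cast (by positivity : d i + 1 ≠ 0)
  rw [diagRes, diagOp_apply]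
  push_cast
  field_simp

/-- The operator `(D + T - z) (D + 1)⁻¹` on `ℓ²`. -/
def shiftOp {ι : Type*} (d : ι → ℝ) (hd : ∀ i, 0 ≤ d i)
    (T : lp (fun _ : ι => ℂ) 2 →L[ℂ] lp (fun _ : ι => ℂ) 2) (z : ℂ) :
    lp (fun _ : ι => ℂ) 2 →L[ℂ] lp (fun _ : ι => ℂ) 2 :=
  1 + (T - (z + 1) • 1) * diagRes d hd

theorem shiftOp_apply {ι : Type*} (d : ι → ℝ) (hd : ∀ i, 0 ≤ d i)
    (T : lp (fun _ : ι => ℂ) 2 →L[ℂ] lp (fun _ : ι => ℂ) 2) (z : ℂ)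
    (h : lp (fun _ : ι => ℂ) 2) :
    shiftOp d hd T z h = h + (T (diagRes d hd h) - (z + 1) • diagRes d hd h) := by
  simp [shiftOp]

theorem shiftOp_apply_apply {ι : Type*} (d : ι → ℝ) (hd : ∀ i, 0 ≤ d i)
    (T : lp (fun _ : ι => ℂ) 2 →L[ℂ] lp (fun _ : ι => ℂ) 2) (z : ℂ)
    (h : lp (fun _ : ι => ℂ) 2) (i : ι) :
    shiftOp d hd T z h i =
      d i * diagRes d hd h i + T (diagRes d hd h) i - z * diagRes d hd h i := by
  rw [shiftOp_apply]
  have := diagRes_apply d hd h i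
  simp only [lp.coeFn_add, lp.coeFn_sub, lp.coeFn_smul, Pi.add_apply, Pi.sub_apply, Pi.smul_apply,
    smul_eq_mul]
  linear_combination -this

/-- `z` is not an eigenvalue of `D + T`. -/
def NotEigenvalue {ι : Type*} (d : ι → ℝ)
    (T : lp (fun _ : ι => ℂ) 2 →L[ℂ] lp (fun _ : ι => ℂ) 2) (z : ℂ) : Prop :=
  ∀ f : lp (fun _ : ι => ℂ) 2, (∀ i, d i * f i + T f i = z * f i) → f = 0

theorem isCompactOperator_diagRes {ι : Type*} (d : ι → ℝ) (hd : ∀ i, 0 ≤ d i)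
    (hinf : Filter.Tendsto d Filter.cofinite Filter.atTop) :
    IsCompactOperator (diagRes d hd) := by
  refine isCompactOperator_diagOp _ _ _ ?_
  have h := Filter.Tendsto.inv_tendsto_atTop (Filter.tendsto_atTop_add_const_right _ (1 : ℝ) hinf)
  simpa [Function.comp_def] using (Complex.continuous_ofReal.tendsto 0).comp h

theorem isUnit_shiftOp {ι : Type*} (d : ι → ℝ) (hd : ∀ i, 0 ≤ d i)
    (hinf : Filter.Tendsto d Filter.cofinite Filter.atTop)
    (T : lp (fun _ : ι => ℂ) 2 →L[ℂ] lp (fun _ : ι => ℂ) 2) {z : ℂ}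
    (hz : NotEigenvalue d T z) : IsUnit (shiftOp d hd T z) := by
  set K := (T - (z + 1) • 1) * diagRes d hd with hK
  have hKc : IsCompactOperator K :=
    (isCompactOperator_diagRes d hd hinf).clm_comp
      (T - (z + 1) • (1 : lp (fun _ : ι => ℂ) 2 →L[ℂ] lp (fun _ : ι => ℂ) 2))
  rcases hKc.hasEigenvalue_or_mem_resolventSet (μ := -1) (by norm_num) with h | h
  · exfalso
    obtain ⟨v, hv⟩ := h.exists_hasEigenvector
    have h1 : K v = (-1 : ℂ) • v := hv.apply_eq_smul
    have h2 : shiftOp d hd T z v = 0 := by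
      change v + K v = 0
      rw [h1]; simp
    have h3 : diagRes d hd v = 0 := hz _ fun i => by
      have := shiftOp_apply_apply d hd T z v i
      rw [h2] at this
      simp only [lp.coeFn_zero, Pi.zero_apply] at this
      linear_combination -this
    refine hv.2 (lp.ext ?_)
    funext i
    rw [← diagRes_apply d hd v i, h3]
    simp
  · rw [spectrum.mem_resolventSet_iff] at h
    have : shiftOp d hd T z = -(algebraMap ℂ _ (-1) - K) := by
      simp [shiftOp, hK, add_comm]
    rw [this]
    exact h.neg

theorem norm_diagRes_le {ι : Type*} (d : ι → ℝ) (hd : ∀ i, 0 ≤ d i)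
    (hinf : Filter.Tendsto d Filter.cofinite Filter.atTop)
    (T : lp (fun _ : ι => ℂ) 2 →L[ℂ] lp (fun _ : ι => ℂ) 2) (hT : IsSelfAdjoint T)
    {z : ℂ} {ρ : ℝ} (hρ : 0 < ρ)
    (hgap : ∀ lam : ℂ, ‖lam - z‖ < ρ → NotEigenvalue d T lam)
    (hconj : NotEigenvalue d T (starRingEnd ℂ z)) (h : lp (fun _ : ι => ℂ) 2) :
    ‖diagRes d hd h‖ ≤ ρ⁻¹ * ‖shiftOp d hd T z h‖ := by
  set R := diagRes d hd with hR
  have hRs : star R = R := isSelfAdjoint_diagOp _ _ _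
  obtain ⟨U, hU⟩ := isUnit_shiftOp d hd hinf T (hgap z (by simpa using hρ))
  obtain ⟨V, hV⟩ := isUnit_shiftOp d hd hinf T hconj
  have hUd : (U : lp (fun _ : ι => ℂ) 2 →L[ℂ] lp (fun _ : ι => ℂ) 2)
      = 1 + (T - (z + 1) • 1) * R := hU
  have hVd : (V : lp (fun _ : ι => ℂ) 2 →L[ℂ] lp (fun _ : ι => ℂ) 2)
      = 1 + (T - (starRingEnd ℂ z + 1) • 1) * R := hV
  set G : lp (fun _ : ι => ℂ) 2 →L[ℂ] lp (fun _ : ι => ℂ) 2 := R * ↑U⁻¹ with hG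
  have hstar : star G = R * ↑V⁻¹ := by
    have e : star (U : lp (fun _ : ι => ℂ) 2 →L[ℂ] lp (fun _ : ι => ℂ) 2) * R = R * V := by
      rw [hUd, hVd, star_add, star_mul, hRs, star_sub, hT.star_eq, star_smul]
      simp [add_mul, mul_add, mul_assoc, sub_mul, mul_sub]
    have e2 : star G = star (↑U⁻¹ : lp (fun _ : ι => ℂ) 2 →L[ℂ] lp (fun _ : ι => ℂ) 2) * R := by
      rw [hG, star_mul, hRs]
    rw [e2, Units.eq_mul_inv_iff_mul_eq, mul_assoc, ← e, ← mul_assoc, ← star_mul]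
    simp
  have hcomm : (R * ↑U⁻¹) * (R * ↑V⁻¹) = (R * ↑V⁻¹) * (R * ↑U⁻¹) := by
    by_cases hzz : starRingEnd ℂ z = z
    · have : U = V := Units.ext (by rw [hUd, hVd, hzz])
      rw [this]
    · have hne : (z - starRingEnd ℂ z) ≠ 0 := sub_ne_zero.2 (Ne.symm hzz)
      have hdiff : (V : lp (fun _ : ι => ℂ) 2 →L[ℂ] lp (fun _ : ι => ℂ) 2) - U
          = (z - starRingEnd ℂ z) • R := by
        rw [hUd, hVd]
        simp only [sub_mul, add_smul, sub_smul, add_mul, smul_mul_assoc, one_mul]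
        abel
      have e1 : R * ↑U⁻¹ - R * ↑V⁻¹ = (z - starRingEnd ℂ z) • ((R * ↑U⁻¹) * (R * ↑V⁻¹)) := by
        have : (z - starRingEnd ℂ z) • ((R * ↑U⁻¹) * (R * ↑V⁻¹)) =
            R * ↑U⁻¹ * ((z - starRingEnd ℂ z) • R) * ↑V⁻¹ := by
          simp only [mul_smul_comm, smul_mul_assoc, mul_assoc]
        rw [this, ← hdiff]
        simp [mul_sub, sub_mul, mul_assoc]
      have e2 : R * ↑U⁻¹ - R * ↑V⁻¹ = (z - starRingEnd ℂ z) • ((R * ↑V⁻¹) * (R * ↑U⁻¹)) := by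
        have : (z - starRingEnd ℂ z) • ((R * ↑V⁻¹) * (R * ↑U⁻¹)) =
            R * ↑V⁻¹ * ((z - starRingEnd ℂ z) • R) * ↑U⁻¹ := by
          simp only [mul_smul_comm, smul_mul_assoc, mul_assoc]
        rw [this, ← hdiff]
        simp [mul_sub, sub_mul, mul_assoc]
      exact smul_right_injective _ hne (e1.symm.trans e2)
  have hnormal : IsStarNormal G := ⟨by rw [hstar]; exact hcomm.symm⟩
  have hGc : IsCompactOperator G :=
    (isCompactOperator_diagRes d hd hinf).comp_clm
      (↑U⁻¹ : lp (fun _ : ι => ℂ) 2 →L[ℂ] lp (fun _ : ι => ℂ) 2)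
  have hspec : ∀ ν ∈ spectrum ℂ G, ‖ν‖ ≤ ρ⁻¹ := by
    intro ν hν
    by_cases hν0 : ν = 0
    · simp [hν0, hρ.le]
    obtain ⟨f, hf⟩ := ((hGc.hasEigenvalue_iff_mem_spectrum hν0).2 hν).exists_hasEigenvector
    have h1 : R ((↑U⁻¹ : lp (fun _ : ι => ℂ) 2 →L[ℂ] lp (fun _ : ι => ℂ) 2) f) = ν • f :=
      hf.apply_eq_smul
    have h2 : shiftOp d hd T z ((↑U⁻¹ : lp (fun _ : ι => ℂ) 2 →L[ℂ] lp (fun _ : ι => ℂ) 2) f)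
        = f := by
      rw [← hU, ← mul_apply_eq_comp]
      simp
    by_contra hcon
    refine hf.2 (hgap (z + ν⁻¹) ?_ f fun i => ?_)
    · rw [add_sub_cancel_left, norm_inv]
      exact inv_lt_of_inv_lt₀ hρ (not_le.1 hcon)
    · have h3 := shiftOp_apply_apply d hd T z
        ((↑U⁻¹ : lp (fun _ : ι => ℂ) 2 →L[ℂ] lp (fun _ : ι => ℂ) 2) f) i
      rw [h2, ← hR, h1, map_smul] at h3
      simp only [lp.coeFn_smul, Pi.smul_apply, smul_eq_mul] at h3
      field_simp
      linear_combination -h3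
  have hGn : ‖G‖ ≤ ρ⁻¹ := by
    have h1 := IsStarNormal.spectralRadius_eq_nnnorm G
    have h2 : spectralRadius ℂ G ≤ (Real.toNNReal ρ⁻¹ : ENNReal) := by
      refine iSup₂_le fun ν hν => ?_
      exact_mod_cast NNReal.le_toNNReal_of_coe_le (hspec ν hν)
    rw [h1, ENNReal.coe_le_coe, Real.le_toNNReal_iff_coe_le (by positivity)] at h2
    exact h2
  have : G (shiftOp d hd T z h) = R h := by
    rw [← hU, hG, ← mul_apply_eq_comp, mul_assoc]
    simp
  rw [← this]
  exact G.le_of_opNorm_le hGn _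

theorem isUnit_add_of_relative_bound {E : Type*} [NormedAddCommGroup E] [NormedSpace ℂ E]
    [CompleteSpace E] {Z P : E →L[ℂ] E} (hZ : IsUnit Z) (h : ∀ x, ‖P x‖ ≤ 1 / 2 * ‖Z x‖) :
    IsUnit (Z + P) := by
  obtain ⟨U, rfl⟩ := hZ
  have h1 : ‖-(P * (↑U⁻¹ : E →L[ℂ] E))‖ < 1 := by
    rw [norm_neg]
    refine lt_of_le_of_lt (ContinuousLinearMap.opNorm_le_bound _ one_half_pos.le fun x => ?_)
      one_half_lt_one
    refine (h _).trans (le_of_eq ?_)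
    have e : (U : E →L[ℂ] E) * ↑U⁻¹ = 1 := U.mul_inv
    exact congrArg (fun S : E →L[ℂ] E => 1 / 2 * ‖S x‖) e
  convert (Units.oneSub _ h1).isUnit.mul U.isUnit using 1
  simp [add_mul, mul_assoc]

theorem exists_unique_solution_of_relative_perturbation {ι : Type*} (d : ι → ℝ)
    (hd : ∀ i, 0 ≤ d i) (hinf : Filter.Tendsto d Filter.cofinite Filter.atTop)
    (T : lp (fun _ : ι => ℂ) 2 →L[ℂ] lp (fun _ : ι => ℂ) 2) (hT : IsSelfAdjoint T)
    {C : ℝ} (hTC : ‖T‖ ≤ C) {z : ℂ} {ρ : ℝ} (hρ : 0 < ρ)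
    (hgap : ∀ lam : ℂ, ‖lam - z‖ < ρ → NotEigenvalue d T lam)
    (hconj : NotEigenvalue d T (starRingEnd ℂ z))
    (B : ι → ℂ) {κ s : ℝ} (hκ : 0 ≤ κ) (hκ2 : κ ≤ 1 / 2) (hs : 0 ≤ s) (hs1 : s ≤ 1)
    (hB : ∀ i, ‖B i‖ ≤ κ * (1 + s * d i))
    (hsmall : κ * (ρ⁻¹ + s * (1 + (C + ‖z‖ + 1) * ρ⁻¹)) ≤ 1 / 2)
    (g : lp (fun _ : ι => ℂ) 2) :
    ∃ f : lp (fun _ : ι => ℂ) 2,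
      (∀ i, ((d i : ℂ) + B i) * f i + T f i - z * f i = g i) ∧ ‖f‖ ≤ 2 * ρ⁻¹ * ‖g‖ ∧
      ∀ f' : lp (fun _ : ι => ℂ) 2,
        (∀ i, ((d i : ℂ) + B i) * f' i + T f' i - z * f' i = g i) → f' = f := by
  set R := diagRes d hd with hR
  set Z := shiftOp d hd T z with hZ
  have hd1 : ∀ i, (0 : ℝ) < d i + 1 := fun i => by linarith [hd i]
  have hd1C : ∀ i, ((d i : ℂ) + 1) ≠ 0 := fun i => by exact_mod_cast (hd1 i).ne'
  have hnd : ∀ i, ‖((d i : ℂ) + 1)‖ = d i + 1 := fun i => by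
    rw [← Complex.ofReal_one, ← Complex.ofReal_add, Complex.norm_real,
      Real.norm_of_nonneg (hd1 i).le]
  have hB1 : ∀ i, ‖B i‖ ≤ κ * (d i + 1) := fun i => (hB i).trans (by
    have := mul_le_mul_of_nonneg_right hs1 (hd i)
    exact mul_le_mul_of_nonneg_left (by linarith) hκ)
  have hb : ∀ i, ‖B i / ((d i : ℂ) + 1)‖ ≤ κ := fun i => by
    rw [norm_div, hnd, div_le_iff₀ (hd1 i)]
    exact hB1 i
  set P := diagOp (fun i => B i / ((d i : ℂ) + 1)) hκ hb with hP
  have hPR : ∀ (h : lp (fun _ : ι => ℂ) 2) i, P h i = B i * R h i := fun h i => by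
    rw [hP, diagOp_apply, ← diagRes_apply d hd h i]
    have := hd1C i
    rw [← hR]
    field_simp
  have hPn : ∀ h : lp (fun _ : ι => ℂ) 2, ‖P h‖ ≤ κ * (‖R h‖ + s * ‖h‖) := by
    intro h
    have h1 : ‖P h‖ ≤ ‖(κ : ℂ) • (R h + (s : ℂ) • h)‖ := by
      refine lp.norm_mono (by norm_num) fun i => ?_
      have e : ((κ : ℂ) • (R h + (s : ℂ) • h)) i
          = ((κ * (1 + s * (d i + 1)) : ℝ) : ℂ) * R h i := by
        simp only [lp.coeFn_smul, lp.coeFn_add, Pi.smul_apply, Pi.add_apply, smul_eq_mul]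
        rw [← diagRes_apply d hd h i]
        push_cast
        ring
      rw [hPR, e, norm_mul, norm_mul, Complex.norm_real]
      refine mul_le_mul_of_nonneg_right ((hB i).trans ?_) (norm_nonneg _)
      refine le_trans (mul_le_mul_of_nonneg_left ?_ hκ) (Real.le_norm_self _)
      linarith
    refine h1.trans ?_
    rw [norm_smul, Complex.norm_real, Real.norm_of_nonneg hκ]
    refine mul_le_mul_of_nonneg_left ((norm_add_le _ _).trans ?_) hκ
    rw [norm_smul, Complex.norm_real, Real.norm_of_nonneg hs]
  have hRn : ∀ h : lp (fun _ : ι => ℂ) 2, ‖R h‖ ≤ ρ⁻¹ * ‖Z h‖ :=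
    norm_diagRes_le d hd hinf T hT hρ hgap hconj
  have hC0 : 0 ≤ C := (norm_nonneg T).trans hTC
  have hPZ : ∀ h : lp (fun _ : ι => ℂ) 2, ‖P h‖ ≤ 1 / 2 * ‖Z h‖ := by
    intro h
    have h1 : ‖h‖ ≤ ‖Z h‖ + (C + ‖z‖ + 1) * ‖R h‖ := by
      have e : h = Z h - (T (R h) - (z + 1) • R h) := by
        rw [hZ, shiftOp_apply]; abel
      have e1 : ‖T (R h)‖ ≤ C * ‖R h‖ := T.le_of_opNorm_le hTC _
      have e2 : ‖(z + 1) • R h‖ ≤ (‖z‖ + 1) * ‖R h‖ := by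
        rw [norm_smul]
        refine mul_le_mul_of_nonneg_right ((norm_add_le _ _).trans ?_) (norm_nonneg _)
        simp
      have e3 := norm_sub_le (Z h) (T (R h) - (z + 1) • R h)
      have e4 := norm_sub_le (T (R h)) ((z + 1) • R h)
      rw [← e] at e3
      linarith
    have h2 : ‖R h‖ + s * ‖h‖ ≤ (ρ⁻¹ + s * (1 + (C + ‖z‖ + 1) * ρ⁻¹)) * ‖Z h‖ := by
      have h3 : (C + ‖z‖ + 1) * ‖R h‖ ≤ (C + ‖z‖ + 1) * (ρ⁻¹ * ‖Z h‖) :=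
        mul_le_mul_of_nonneg_left (hRn h) (by positivity)
      have h4 := mul_le_mul_of_nonneg_left (h1.trans (add_le_add_right h3 _)) hs
      have := hRn h
      linarith
    calc ‖P h‖ ≤ κ * (‖R h‖ + s * ‖h‖) := hPn h
      _ ≤ κ * ((ρ⁻¹ + s * (1 + (C + ‖z‖ + 1) * ρ⁻¹)) * ‖Z h‖) :=
        mul_le_mul_of_nonneg_left h2 hκ
      _ ≤ 1 / 2 * ‖Z h‖ := by
        rw [← mul_assoc]
        exact mul_le_mul_of_nonneg_right hsmall (norm_nonneg _)
  have hunit : IsUnit (Z + P) :=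
    isUnit_add_of_relative_bound (isUnit_shiftOp d hd hinf T (hgap z (by simpa using hρ))) hPZ
  obtain ⟨V, hV⟩ := hunit
  have hVapp : ∀ (h : lp (fun _ : ι => ℂ) 2) i,
      (Z + P) h i = ((d i : ℂ) + B i) * R h i + T (R h) i - z * R h i := fun h i => by
    rw [add_apply, lp.coeFn_add, Pi.add_apply, hPR, hZ, shiftOp_apply_apply]
    ring
  set h₀ := (↑V⁻¹ : lp (fun _ : ι => ℂ) 2 →L[ℂ] lp (fun _ : ι => ℂ) 2) g with hh₀
  have hsol : (Z + P) h₀ = g := by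
    rw [← hV, hh₀, ← mul_apply_eq_comp]
    simp
  refine ⟨R h₀, fun i => by rw [← hVapp, hsol], ?_, fun f' hf' => ?_⟩
  · have h1 : ‖Z h₀‖ ≤ 2 * ‖g‖ := by
      have e : Z h₀ = g - P h₀ := by
        rw [← hsol, add_apply]; abel
      have := norm_sub_le g (P h₀)
      rw [← e] at this
      linarith [hPZ h₀]
    calc ‖R h₀‖ ≤ ρ⁻¹ * ‖Z h₀‖ := hRn h₀
      _ ≤ ρ⁻¹ * (2 * ‖g‖) := mul_le_mul_of_nonneg_left h1 (by positivity)
      _ = 2 * ρ⁻¹ * ‖g‖ := by ring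
  · have hmem : Memℓp (fun i => ((d i : ℂ) + 1) * f' i) 2 := by
      refine Memℓp.mono' (lp.memℓp ((2 : ℂ) • (g + (z + 1) • f' - T f'))) fun i => ?_
      have e : ((2 : ℂ) • (g + (z + 1) • f' - T f')) i
          = 2 * (((d i : ℂ) + 1) * f' i + B i * f' i) := by
        simp only [lp.coeFn_smul, lp.coeFn_add, lp.coeFn_sub, Pi.smul_apply, Pi.add_apply,
          Pi.sub_apply, smul_eq_mul]
        linear_combination -2 * hf' i
      have e2 : ‖B i * f' i‖ ≤ 1 / 2 * ‖((d i : ℂ) + 1) * f' i‖ := by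
        rw [norm_mul, norm_mul, hnd, ← mul_assoc]
        refine mul_le_mul_of_nonneg_right ((hB1 i).trans ?_) (norm_nonneg _)
        exact mul_le_mul_of_nonneg_right hκ2 (hd1 i).le
      have e3 := norm_sub_le (((d i : ℂ) + 1) * f' i + B i * f' i) (B i * f' i)
      rw [add_sub_cancel_right] at e3
      rw [e, norm_mul 2, Complex.norm_two]
      linarith
    set h' : lp (fun _ : ι => ℂ) 2 := ⟨_, hmem⟩ with hh'
    have hRf : R h' = f' := by
      refine lp.ext (funext fun i => mul_left_cancel₀ (hd1C i) ?_)
      exact diagRes_apply d hd h' i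
    have hsol' : (Z + P) h' = g := by
      refine lp.ext (funext fun i => ?_)
      rw [hVapp, hRf, hf']
    have : h' = h₀ := by
      rw [hh₀, ← hsol', ← hV, ← mul_apply_eq_comp]
      simp
    rw [← hRf, this]

theorem exists_compression_operator {ι H : Type*} [NormedAddCommGroup H] [InnerProductSpace ℂ H]
    [CompleteSpace H] {v : ι → H} (hv : Orthonormal ℂ v) {M : H →L[ℂ] H} (hM : IsSelfAdjoint M) :
    ∃ T : lp (fun _ : ι => ℂ) 2 →L[ℂ] lp (fun _ : ι => ℂ) 2, IsSelfAdjoint T ∧ ‖T‖ ≤ ‖M‖ ∧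
      ∀ f i, HasSum (fun j => inner ℂ (v i) (M (v j)) * f j) (T f i) := by
  classical
  set V : lp (fun _ : ι => ℂ) 2 →L[ℂ] H :=
    hv.orthogonalFamily.linearIsometry.toContinuousLinearMap with hV
  have hVn : ‖V‖ ≤ 1 := LinearIsometry.norm_toContinuousLinearMap_le _
  have hsum : ∀ f : lp (fun _ : ι => ℂ) 2, HasSum (fun j => f j • v j) (V f) := fun f => by
    change HasSum _ (hv.orthogonalFamily.linearIsometry f)
    simpa using hv.orthogonalFamily.hasSum_linearIsometry f
  have hsingle : ∀ i, V (lp.single 2 i (1 : ℂ)) = v i := fun i => by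
    change hv.orthogonalFamily.linearIsometry _ = _
    rw [hv.orthogonalFamily.linearIsometry_apply_single]
    simp
  refine ⟨ContinuousLinearMap.adjoint V ∘L M ∘L V, ?_, ?_, fun f i => ?_⟩
  · rw [ContinuousLinearMap.isSelfAdjoint_iff_isSymmetric]
    have hs := (ContinuousLinearMap.isSelfAdjoint_iff_isSymmetric).1 hM
    intro f g
    have := hs (V f) (V g)
    simp only [ContinuousLinearMap.coe_coe] at this
    simp [ContinuousLinearMap.adjoint_inner_left, ContinuousLinearMap.adjoint_inner_right, this]
  · refine (ContinuousLinearMap.opNorm_comp_le _ _).trans ?_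
    rw [LinearIsometryEquiv.norm_map]
    have h1 := ContinuousLinearMap.opNorm_comp_le M V
    have h2 : ‖M‖ * ‖V‖ ≤ ‖M‖ * 1 := mul_le_mul_of_nonneg_left hVn (norm_nonneg _)
    have h3 : ‖V‖ * ‖M ∘L V‖ ≤ 1 * ‖M ∘L V‖ := mul_le_mul_of_nonneg_right hVn (norm_nonneg _)
    linarith
  · have e : (ContinuousLinearMap.adjoint V ∘L M ∘L V) f i = inner ℂ (v i) (M (V f)) := by
      rw [← hsingle i, ← ContinuousLinearMap.adjoint_inner_right, lp.inner_single_left]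
      simp
    rw [e]
    have := ((innerSL ℂ (v i)).comp M).hasSum (hsum f)
    simpa [mul_comm] using this

/-- Multiplication by a bounded measurable real function on `L²`. -/
theorem exists_mul_operator {X : Type*} [MeasurableSpace X] (μ : MeasureTheory.Measure X)
    {W : X → ℝ} (hW : Measurable W) {C : ℝ} (hWC : ∀ x, |W x| ≤ C) (hC : 0 ≤ C) :
    ∃ M : MeasureTheory.Lp ℂ 2 μ →L[ℂ] MeasureTheory.Lp ℂ 2 μ, IsSelfAdjoint M ∧ ‖M‖ ≤ C ∧
      ∀ f, M f =ᵐ[μ] fun x => (W x : ℂ) * f x := by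
  have hWi : MeasureTheory.MemLp (fun x => (W x : ℂ)) ⊤ μ :=
    MeasureTheory.memLp_top_of_bound (by fun_prop) C
      (Filter.Eventually.of_forall fun x => by simpa using hWC x)
  have hmem : ∀ f : MeasureTheory.Lp ℂ 2 μ,
      MeasureTheory.MemLp (fun x => (W x : ℂ) * f x) 2 μ := fun f => by
    simpa [mul_comm] using (MeasureTheory.Lp.memLp f).mul' hWi
  have hae : ∀ f, (hmem f).toLp =ᵐ[μ] fun x => (W x : ℂ) * f x := fun f =>
    (hmem f).coeFn_toLp
  let M₀ : MeasureTheory.Lp ℂ 2 μ →ₗ[ℂ] MeasureTheory.Lp ℂ 2 μ :=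
    { toFun := fun f => (hmem f).toLp
      map_add' := fun f g => by
        refine MeasureTheory.Lp.ext ?_
        filter_upwards [hae (f + g), hae f, hae g, MeasureTheory.Lp.coeFn_add f g,
          MeasureTheory.Lp.coeFn_add (hmem f).toLp (hmem g).toLp] with x h1 h2 h3 h4 h5
        rw [h1, h5, h4, Pi.add_apply, Pi.add_apply, h2, h3]
        ring
      map_smul' := fun c f => by
        refine MeasureTheory.Lp.ext ?_
        filter_upwards [hae (c • f), hae f, MeasureTheory.Lp.coeFn_smul c f,
          MeasureTheory.Lp.coeFn_smul c (hmem f).toLp] with x h1 h2 h3 h4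
        rw [RingHom.id_apply, h1, h4, h3, Pi.smul_apply, Pi.smul_apply, h2, smul_eq_mul,
          smul_eq_mul]
        ring }
  have hbound : ∀ f, ‖M₀ f‖ ≤ C * ‖f‖ := fun f => by
    refine MeasureTheory.Lp.norm_le_mul_norm_of_ae_le_mul ?_
    filter_upwards [hae f] with x hx
    change ‖(MeasureTheory.MemLp.toLp _ (hmem f) : X → ℂ) x‖ ≤ _
    rw [hx, norm_mul, Complex.norm_real]
    exact mul_le_mul_of_nonneg_right (hWC x) (norm_nonneg _)
  refine ⟨M₀.mkContinuous C hbound, ?_, M₀.mkContinuous_norm_le hC hbound, hae⟩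
  rw [ContinuousLinearMap.isSelfAdjoint_iff_isSymmetric]
  intro f g
  rw [MeasureTheory.L2.inner_def, MeasureTheory.L2.inner_def]
  refine MeasureTheory.integral_congr_ae ?_
  filter_upwards [hae f, hae g] with x h1 h2
  change inner ℂ ((MeasureTheory.MemLp.toLp _ (hmem f) : X → ℂ) x) (g x) =
    inner ℂ (f x) ((MeasureTheory.MemLp.toLp _ (hmem g) : X → ℂ) x)
  rw [h1, h2]
  simp
  ring

/-- The plane wave `exp(i⟨p_j(0), x⟩)`. -/
def planeWave (a₁ a₂ : ℝ) (j : ℤ × ℤ) (x : ℝ × ℝ) : ℂ :=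
  Complex.exp (Complex.I * (((pvec a₁ a₂ j).1 * x.1 + (pvec a₁ a₂ j).2 * x.2 : ℝ) : ℂ))

theorem norm_planeWave (a₁ a₂ : ℝ) (j : ℤ × ℤ) (x : ℝ × ℝ) : ‖planeWave a₁ a₂ j x‖ = 1 := by
  rw [planeWave, mul_comm, Complex.norm_exp_ofReal_mul_I]

theorem continuous_planeWave (a₁ a₂ : ℝ) (j : ℤ × ℤ) : Continuous (planeWave a₁ a₂ j) := by
  unfold planeWave
  fun_prop

theorem conj_planeWave_mul (a₁ a₂ : ℝ) (i j : ℤ × ℤ) (x : ℝ × ℝ) :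
    starRingEnd ℂ (planeWave a₁ a₂ i x) * planeWave a₁ a₂ j x = planeWave a₁ a₂ (j - i) x := by
  simp only [planeWave, ← Complex.exp_conj, ← Complex.exp_add, pvec]
  congr 1
  simp only [map_mul, Complex.conj_I, Complex.conj_ofReal, Prod.fst_sub, Prod.snd_sub]
  push_cast
  ring

theorem integral_exp_period {a : ℝ} (ha : 0 < a) (n : ℤ) :
    ∫ x in Icc (0 : ℝ) a, Complex.exp (Complex.I * ((2 * π * n / a * x : ℝ) : ℂ))
      = if n = 0 then (a : ℂ) else 0 := by
  rw [MeasureTheory.integral_Icc_eq_integral_Ioc, ← intervalIntegral.integral_of_le ha.le]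
  split_ifs with hn
  · simp [hn]
  · have ha' : (a : ℂ) ≠ 0 := by exact_mod_cast ha.ne'
    have hn' : (n : ℂ) ≠ 0 := by exact_mod_cast hn
    have hπ : (π : ℂ) ≠ 0 := by exact_mod_cast Real.pi_ne_zero
    have hc : (2 * π * Complex.I * n / a : ℂ) ≠ 0 := by
      simp [ha', hn', hπ]
    have h1 : ∀ x : ℝ, Complex.I * ((2 * π * n / a * x : ℝ) : ℂ)
        = (2 * π * Complex.I * n / a : ℂ) * x := fun x => by push_cast; ring
    simp_rw [h1]
    rw [integral_exp_mul_complex hc]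
    have h2 : (2 * π * Complex.I * n / a : ℂ) * a = n * (2 * π * Complex.I) := by
      field_simp
    rw [h2, Complex.exp_int_mul_two_pi_mul_I]
    simp

theorem integral_planeWave {a₁ a₂ : ℝ} (ha₁ : 0 < a₁) (ha₂ : 0 < a₂) (j : ℤ × ℤ) :
    ∫ x in Icc (0 : ℝ × ℝ) (a₁, a₂), planeWave a₁ a₂ j x
      = if j = 0 then ((a₁ * a₂ : ℝ) : ℂ) else 0 := by
  have h : ∀ x : ℝ × ℝ, planeWave a₁ a₂ j x
      = Complex.exp (Complex.I * ((2 * π * j.1 / a₁ * x.1 : ℝ) : ℂ))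
        * Complex.exp (Complex.I * ((2 * π * j.2 / a₂ * x.2 : ℝ) : ℂ)) := fun x => by
    rw [← Complex.exp_add, planeWave, pvec]
    congr 1
    push_cast
    ring
  have hI : Icc (0 : ℝ × ℝ) (a₁, a₂) = Icc 0 a₁ ×ˢ Icc 0 a₂ := by
    rw [Set.Icc_prod_Icc]; rfl
  simp_rw [h]
  rw [hI, MeasureTheory.Measure.volume_eq_prod, MeasureTheory.setIntegral_prod_mul
    (fun x : ℝ => Complex.exp (Complex.I * ((2 * π * j.1 / a₁ * x : ℝ) : ℂ)))
    (fun x : ℝ => Complex.exp (Complex.I * ((2 * π * j.2 / a₂ * x : ℝ) : ℂ))),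
    integral_exp_period ha₁, integral_exp_period ha₂]
  by_cases h1 : j.1 = 0 <;> by_cases h2 : j.2 = 0 <;> simp [h1, h2, Prod.ext_iff]

theorem fCoeff_eq_integral_planeWave (a₁ a₂ : ℝ) (W : ℝ × ℝ → ℝ) (j : ℤ × ℤ) :
    fCoeff a₁ a₂ W j = ((a₁ * a₂ : ℝ) : ℂ)⁻¹ *
      ∫ x in Icc (0 : ℝ × ℝ) (a₁, a₂), (W x : ℂ) * planeWave a₁ a₂ (-j) x := by
  rw [fCoeff]
  congr 2
  funext x
  rw [planeWave]
  congr 2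
  simp only [pvec, Prod.fst_neg, Prod.snd_neg]
  push_cast
  ring

/-- The product of the plane waves indexed by the quotient and the remainder of `m` modulo `N`,
normalized on the square of the cell. -/
def doubleWave (N : ℕ) (a₁ a₂ : ℝ) (m : ℤ × ℤ) (x : (ℝ × ℝ) × (ℝ × ℝ)) : ℂ :=
  ((a₁ * a₂ : ℝ) : ℂ)⁻¹ * (planeWave a₁ a₂ (m.1 / N, m.2 / N) x.1 *
    planeWave a₁ a₂ (m.1 % N, m.2 % N) x.2)

theorem integral_doubleWave (N : ℕ) {a₁ a₂ : ℝ} (ha₁ : 0 < a₁) (ha₂ : 0 < a₂)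
    (g : ℝ × ℝ → ℝ) (m q : ℤ × ℤ) :
    ∫ x, starRingEnd ℂ (doubleWave N a₁ a₂ m x) * ((g x.1 : ℂ) * doubleWave N a₁ a₂ q x)
      ∂((MeasureTheory.volume.restrict (Icc (0 : ℝ × ℝ) (a₁, a₂))).prod
        (MeasureTheory.volume.restrict (Icc (0 : ℝ × ℝ) (a₁, a₂))))
      = if (m.1 % N, m.2 % N) = (q.1 % N, q.2 % N) then
        fCoeff a₁ a₂ g ((m.1 / N, m.2 / N) - (q.1 / N, q.2 / N)) else 0 := by
  have ha : ((a₁ * a₂ : ℝ) : ℂ) ≠ 0 := by exact_mod_cast (mul_pos ha₁ ha₂).ne'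
  have h : ∀ x : (ℝ × ℝ) × (ℝ × ℝ),
      starRingEnd ℂ (doubleWave N a₁ a₂ m x) * ((g x.1 : ℂ) * doubleWave N a₁ a₂ q x)
      = (((a₁ * a₂ : ℝ) : ℂ)⁻¹ * ((g x.1 : ℂ) *
          planeWave a₁ a₂ (-((m.1 / N, m.2 / N) - (q.1 / N, q.2 / N))) x.1)) *
        (((a₁ * a₂ : ℝ) : ℂ)⁻¹ *
          planeWave a₁ a₂ ((q.1 % N, q.2 % N) - (m.1 % N, m.2 % N)) x.2) := fun x => by
    rw [neg_sub, ← conj_planeWave_mul, ← conj_planeWave_mul]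
    simp only [doubleWave, map_mul, map_inv₀, Complex.conj_ofReal]
    ring
  simp_rw [h]
  rw [MeasureTheory.integral_prod_mul
    (fun x : ℝ × ℝ => ((a₁ * a₂ : ℝ) : ℂ)⁻¹ * ((g x : ℂ) *
          planeWave a₁ a₂ (-((m.1 / N, m.2 / N) - (q.1 / N, q.2 / N))) x))
    (fun x : ℝ × ℝ => ((a₁ * a₂ : ℝ) : ℂ)⁻¹ *
          planeWave a₁ a₂ ((q.1 % N, q.2 % N) - (m.1 % N, m.2 % N)) x),
    MeasureTheory.integral_const_mul, MeasureTheory.integral_const_mul,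
    integral_planeWave ha₁ ha₂, ← fCoeff_eq_integral_planeWave]
  by_cases hmq : (m.1 % N, m.2 % N) = (q.1 % N, q.2 % N)
  · rw [if_pos (by rw [hmq, sub_self]), if_pos hmq, inv_mul_cancel₀ ha, mul_one]
  · rw [if_neg (fun h0 => hmq (sub_eq_zero.1 h0).symm), if_neg hmq, mul_zero, mul_zero]

theorem wtil_sub_eq {N : ℕ} (w : ℤ × ℤ → ℂ) (m q : ℤ × ℤ) :
    wtil N w (m - q) = if (m.1 % N, m.2 % N) = (q.1 % N, q.2 % N) then
      w ((m.1 / N, m.2 / N) - (q.1 / N, q.2 / N)) else 0 := by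
  have hiff : ∀ a b : ℤ, (N : ℤ) ∣ a - b ↔ a % N = b % N := fun a b => by
    rw [Int.emod_eq_emod_iff_emod_sub_eq_zero, Int.dvd_iff_emod_eq_zero]
  have hdiv : ∀ a b : ℤ, a % N = b % N → (a - b) / N = a / N - b / N := fun a b hab => by
    rcases eq_or_ne (N : ℤ) 0 with h0 | h0
    · simp [h0]
    · have h1 := Int.emod_add_mul_ediv a N
      have h2 := Int.emod_add_mul_ediv b N
      refine Int.ediv_eq_of_eq_mul_right h0 ?_
      linear_combination -h1 + h2 + hab
  rw [wtil]
  simp only [Prod.fst_sub, Prod.snd_sub, hiff, Prod.mk.injEq]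
  split_ifs with h
  · rw [hdiv _ _ h.1, hdiv _ _ h.2]
    rfl
  · rfl

theorem exists_convolution_operator (N : ℕ) {a₁ a₂ : ℝ} (ha₁ : 0 < a₁) (ha₂ : 0 < a₂)
    {W : ℝ × ℝ → ℝ} (hW : Measurable W) {C : ℝ} (hWC : ∀ x, |W x| ≤ C)
    {w : ℤ × ℤ → ℂ} (hw : ∀ j, w j = fCoeff a₁ a₂ W j) :
    ∃ T : lp (fun _ : ℤ × ℤ => ℂ) 2 →L[ℂ] lp (fun _ : ℤ × ℤ => ℂ) 2,
      IsSelfAdjoint T ∧ ‖T‖ ≤ C ∧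
      ∀ f m, HasSum (fun q => wtil N w (m - q) * f q) (T f m) := by
  set μ := (MeasureTheory.volume.restrict (Icc (0 : ℝ × ℝ) (a₁, a₂))).prod
        (MeasureTheory.volume.restrict (Icc (0 : ℝ × ℝ) (a₁, a₂))) with hμ
  have hC : 0 ≤ C := (abs_nonneg _).trans (hWC 0)
  have : MeasureTheory.IsFiniteMeasure (MeasureTheory.volume.restrict
      (Icc (0 : ℝ × ℝ) (a₁, a₂))) :=
    ⟨by simpa using isCompact_Icc.measure_lt_top⟩
  have hmem : ∀ m, MeasureTheory.MemLp (doubleWave N a₁ a₂ m) 2 μ := fun m => by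
    refine MeasureTheory.MemLp.of_bound (Continuous.aestronglyMeasurable ?_)
      ‖((a₁ * a₂ : ℝ) : ℂ)⁻¹‖ (Filter.Eventually.of_forall fun x => ?_)
    · have := continuous_planeWave a₁ a₂
      unfold doubleWave
      fun_prop
    · rw [doubleWave, norm_mul, norm_mul, norm_planeWave, norm_planeWave, mul_one, mul_one]
  set v : ℤ × ℤ → MeasureTheory.Lp ℂ 2 μ := fun m => (hmem m).toLp _ with hv
  have hvae : ∀ m, v m =ᵐ[μ] doubleWave N a₁ a₂ m := fun m => (hmem m).coeFn_toLp
  have horth : Orthonormal ℂ v := by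
    rw [orthonormal_iff_ite]
    intro m q
    rw [MeasureTheory.L2.inner_def]
    have h1 : ∫ x, inner ℂ (v m x) (v q x) ∂μ = ∫ x, starRingEnd ℂ (doubleWave N a₁ a₂ m x) *
        ((((fun _ => 1 : ℝ × ℝ → ℝ) x.1 : ℝ) : ℂ) * doubleWave N a₁ a₂ q x) ∂μ := by
      refine MeasureTheory.integral_congr_ae ?_
      filter_upwards [hvae m, hvae q] with x hm hq
      rw [hm, hq]
      simp [mul_comm]
    rw [h1.trans (integral_doubleWave N ha₁ ha₂ (fun _ => (1 : ℝ)) m q),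
      fCoeff_eq_integral_planeWave]
    have ha : ((a₁ * a₂ : ℝ) : ℂ) ≠ 0 := by exact_mod_cast (mul_pos ha₁ ha₂).ne'
    simp only [Complex.ofReal_one, one_mul]
    rw [integral_planeWave ha₁ ha₂]
    have hiff : m = q ↔ (m.1 % (N : ℤ), m.2 % (N : ℤ)) = (q.1 % (N : ℤ), q.2 % (N : ℤ)) ∧
        -((m.1 / (N : ℤ), m.2 / (N : ℤ)) - (q.1 / (N : ℤ), q.2 / (N : ℤ))) = 0 := by
      constructor
      · rintro rfl
        simp
      · rintro ⟨h2, h3⟩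
        rw [neg_sub, sub_eq_zero] at h3
        simp only [Prod.mk.injEq] at h2 h3
        refine Prod.ext ?_ ?_
        · rw [← Int.emod_add_mul_ediv m.1 N, ← Int.emod_add_mul_ediv q.1 N, h2.1, h3.1]
        · rw [← Int.emod_add_mul_ediv m.2 N, ← Int.emod_add_mul_ediv q.2 N, h2.2, h3.2]
    by_cases hmq : m = q
    · obtain ⟨h2, h3⟩ := hiff.1 hmq
      rw [if_pos h2, if_pos h3, if_pos hmq, inv_mul_cancel₀ ha]
    · rw [if_neg hmq]
      by_cases h2 : (m.1 % (N : ℤ), m.2 % (N : ℤ)) = (q.1 % (N : ℤ), q.2 % (N : ℤ))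
      · rw [if_pos h2, if_neg (fun h3 => hmq (hiff.2 ⟨h2, h3⟩)), mul_zero]
      · rw [if_neg h2]
  obtain ⟨M, hM, hMC, hMf⟩ := exists_mul_operator μ (W := fun x => W x.1)
    (hW.comp measurable_fst) (fun x => hWC x.1) hC
  obtain ⟨T, hT, hTn, hTf⟩ := exists_compression_operator horth hM
  refine ⟨T, hT, hTn.trans hMC, fun f m => ?_⟩
  convert hTf f m using 3 with q
  rw [wtil_sub_eq, hw, ← integral_doubleWave N ha₁ ha₂, MeasureTheory.L2.inner_def]
  refine MeasureTheory.integral_congr_ae ?_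
  filter_upwards [hvae m, hvae q, hMf (v q)] with x h1 h2 h3
  rw [h3, h1, h2]
  simp [mul_comm]

theorem finite_setOf_abs_mul_add_le {c : ℝ} (hc : 0 < c) (t R : ℝ) :
    {n : ℤ | |c * n + t| ≤ R}.Finite := by
  refine (Set.finite_Icc ⌈(-R - t) / c⌉ ⌊(R - t) / c⌋).subset fun n hn => ?_
  rw [Set.mem_ofPred_eq, abs_le] at hn
  rw [Set.mem_Icc, Int.ceil_le, Int.le_floor, div_le_iff₀ hc, le_div_iff₀ hc]
  constructor <;> nlinarith [hn.1, hn.2]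

theorem tendsto_sq2_ptil_pow {N l : ℕ} (hN : 0 < N) (hl : l ≠ 0) {a₁ a₂ : ℝ} (ha₁ : 0 < a₁)
    (ha₂ : 0 < a₂) (τ : ℝ × ℝ) :
    Filter.Tendsto (fun m => sq2 (ptil N a₁ a₂ τ m) ^ l) Filter.cofinite Filter.atTop := by
  rw [Filter.tendsto_atTop]
  intro b
  rw [Filter.eventually_cofinite]
  have hN' : (0 : ℝ) < N := by exact_mod_cast hN
  have hf := (finite_setOf_abs_mul_add_le (c := 2 * π / (N * a₁)) (by positivity) τ.1
    (1 + |b|)).prod (finite_setOf_abs_mul_add_le (c := 2 * π / (N * a₂)) (by positivity) τ.2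
    (1 + |b|))
  refine hf.subset fun m hm => ?_
  rw [Set.mem_ofPred_eq, not_le] at hm
  have hx : sq2 (ptil N a₁ a₂ τ m) ≤ 1 + |b| := by
    by_contra! hx
    have h1 : 1 ≤ sq2 (ptil N a₁ a₂ τ m) := by linarith [abs_nonneg b]
    have h2 := le_self_pow₀ h1 hl
    linarith [le_abs_self b]
  have hR : 1 + |b| ≤ (1 + |b|) ^ 2 := by nlinarith [abs_nonneg b]
  rw [sq2, ptil] at hx
  simp only at hx
  rw [Set.mem_prod, Set.mem_ofPred_eq, Set.mem_ofPred_eq]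
  have hR0 : 0 ≤ 1 + |b| := by positivity
  constructor
  · refine abs_le_of_sq_le_sq ?_ hR0
    rw [show 2 * π / (N * a₁) * m.1 + τ.1 = 2 * π * m.1 / (N * a₁) + τ.1 by ring]
    nlinarith [sq_nonneg (2 * π * m.2 / (N * a₂) + τ.2)]
  · refine abs_le_of_sq_le_sq ?_ hR0
    rw [show 2 * π / (N * a₂) * m.2 + τ.2 = 2 * π * m.2 / (N * a₂) + τ.2 by ring]
    nlinarith [sq_nonneg (2 * π * m.1 / (N * a₁) + τ.1)]

theorem norm_pow_succ_sub_pow_succ_le {x y : ℂ} {M : ℝ} (hx : ‖x‖ ≤ M) (hy : ‖y‖ ≤ M) (n : ℕ) :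
    ‖y ^ (n + 1) - x ^ (n + 1)‖ ≤ (n + 1) * M ^ n * ‖y - x‖ := by
  have hM : 0 ≤ M := (norm_nonneg x).trans hx
  induction n with
  | zero => simp
  | succ n ih =>
    have h1 : y ^ (n + 1 + 1) - x ^ (n + 1 + 1)
        = y * (y ^ (n + 1) - x ^ (n + 1)) + (y - x) * x ^ (n + 1) := by ring
    rw [h1]
    calc _ ≤ ‖y * (y ^ (n + 1) - x ^ (n + 1))‖ + ‖(y - x) * x ^ (n + 1)‖ := norm_add_le _ _
      _ ≤ M * ((n + 1) * M ^ n * ‖y - x‖) + ‖y - x‖ * M ^ (n + 1) := by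
        rw [norm_mul, norm_mul, norm_pow]
        gcongr
      _ = _ := by push_cast; ring

theorem norm_nsq_cx_add_sub_le (P : ℝ × ℝ) (u : ℂ × ℂ) :
    ‖nsq (cx P + u) - (sq2 P : ℝ)‖ ≤ cnorm u * (2 * √(sq2 P) + cnorm u) := by
  have h1 : nsq (cx P + u) - (sq2 P : ℝ) = 2 * (P.1 * u.1 + P.2 * u.2) + (u.1 ^ 2 + u.2 ^ 2) := by
    simp only [nsq, cx, sq2, Prod.fst_add, Prod.snd_add]
    push_cast
    ring
  have h2 : ‖(P.1 * u.1 + P.2 * u.2 : ℂ)‖ ≤ √(sq2 P) * cnorm u := by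
    rw [cnorm, sq2, ← Real.sqrt_mul (by positivity)]
    refine Real.le_sqrt_of_sq_le ?_
    have h3 := norm_add_le (P.1 * u.1 : ℂ) (P.2 * u.2)
    rw [norm_mul, norm_mul, Complex.norm_real, Complex.norm_real] at h3
    calc _ ≤ (‖P.1‖ * ‖u.1‖ + ‖P.2‖ * ‖u.2‖) ^ 2 := by gcongr
      _ ≤ (‖P.1‖ ^ 2 + ‖P.2‖ ^ 2) * (‖u.1‖ ^ 2 + ‖u.2‖ ^ 2) := by
        nlinarith [sq_nonneg (‖P.1‖ * ‖u.2‖ - ‖P.2‖ * ‖u.1‖)]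
      _ = _ := by simp only [Real.norm_eq_abs, sq_abs]
  have h4 : ‖u.1 ^ 2 + u.2 ^ 2‖ ≤ cnorm u ^ 2 := by
    rw [cnorm, Real.sq_sqrt (by positivity)]
    exact (norm_add_le _ _).trans_eq (by rw [norm_pow, norm_pow])
  rw [h1]
  calc _ ≤ ‖(2 : ℂ) * (P.1 * u.1 + P.2 * u.2)‖ + ‖u.1 ^ 2 + u.2 ^ 2‖ := norm_add_le _ _
    _ ≤ 2 * (√(sq2 P) * cnorm u) + cnorm u ^ 2 := by
      rw [norm_mul, Complex.norm_ofNat]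
      gcongr
    _ = _ := by ring

theorem norm_nsq_pow_sub_sq2_pow_le (P : ℝ × ℝ) (u : ℂ × ℂ) {l : ℕ} (hl : l ≠ 0) {k : ℝ}
    (hk : cnorm u ≤ k) :
    k * ‖nsq (cx P + u) ^ l - ((sq2 P ^ l : ℝ) : ℂ)‖
      ≤ 2 * l * 4 ^ l * cnorm u * (sq2 P ^ l + k ^ (2 * l)) := by
  obtain ⟨n, rfl⟩ := Nat.exists_eq_succ_of_ne_zero hl
  have hx0 : 0 ≤ sq2 P := by rw [sq2]; positivity
  have hu : 0 ≤ cnorm u := Real.sqrt_nonneg _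
  have hk0 : 0 ≤ k := hu.trans hk
  set r := √(sq2 P) with hr
  have hr0 : 0 ≤ r := Real.sqrt_nonneg _
  have hxr : sq2 P = r ^ 2 := (Real.sq_sqrt hx0).symm
  have h1 := norm_nsq_cx_add_sub_le P u
  rw [← hr] at h1
  have hx : ‖((sq2 P : ℝ) : ℂ)‖ ≤ (r + k) ^ 2 := by
    rw [Complex.norm_real, Real.norm_of_nonneg hx0, hxr]
    gcongr
    linarith
  have hy : ‖nsq (cx P + u)‖ ≤ (r + k) ^ 2 := by
    have h2 : ‖nsq (cx P + u)‖ ≤ ‖nsq (cx P + u) - (sq2 P : ℝ)‖ + ‖((sq2 P : ℝ) : ℂ)‖ := by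
      simpa using norm_add_le (nsq (cx P + u) - (sq2 P : ℝ)) ((sq2 P : ℝ) : ℂ)
    rw [Complex.norm_real, Real.norm_of_nonneg hx0, hxr] at h2
    rw [hxr] at h1
    nlinarith
  have h3 := norm_pow_succ_sub_pow_succ_le hx hy n
  have h4 : ‖nsq (cx P + u) - (sq2 P : ℝ)‖ ≤ cnorm u * (2 * (r + k)) :=
    h1.trans (by gcongr; linarith)
  have h5 := add_pow_le hr0 hk0 (2 * (n + 1))
  have h6 : (2 : ℝ) ^ (2 * (n + 1) - 1) ≤ 4 ^ (n + 1) := by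
    rw [show (4 : ℝ) = 2 ^ 2 by norm_num, ← pow_mul]
    exact pow_le_pow_right₀ (by norm_num) (by omega)
  have h7 : k ≤ r + k := by linarith
  rw [Nat.succ_eq_add_one, Complex.ofReal_pow]
  calc _ ≤ (r + k) * ((n + 1) * ((r + k) ^ 2) ^ n * (cnorm u * (2 * (r + k)))) := by
        gcongr
        exact h3.trans (by gcongr)
    _ = 2 * (n + 1) * cnorm u * (r + k) ^ (2 * (n + 1)) := by rw [← pow_mul]; ring
    _ ≤ 2 * (n + 1) * cnorm u * (4 ^ (n + 1) * (r ^ (2 * (n + 1)) + k ^ (2 * (n + 1)))) := by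
        gcongr
        exact h5.trans (by gcongr)
    _ = _ := by rw [hxr, ← pow_mul]; push_cast; ring

theorem ptilC_eq (N : ℕ) (a₁ a₂ : ℝ) (τ₀ : ℝ × ℝ) (τ : ℂ × ℂ) (m : ℤ × ℤ) :
    ptilC N a₁ a₂ τ m = cx (ptil N a₁ a₂ τ₀ m) + (τ - cx τ₀) := by
  refine Prod.ext ?_ ?_ <;> simp [ptilC, cx, ptil]

theorem norm_nsq_ptilC_pow_sub_le {N l : ℕ} {a₁ a₂ δ ε k : ℝ} {τ₀ : ℝ × ℝ} {τ : ℂ × ℂ}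
    (hl : l ≠ 0) (hδ : 0 < δ) (hk : 1 < k) (hε0 : 0 ≤ ε) (hε : ε ≤ 1)
    (hτ : cnorm (τ - cx τ₀) ≤ ε * k ^ (-2 * (l : ℝ) + 1 - δ)) (m : ℤ × ℤ) :
    ‖nsq (ptilC N a₁ a₂ τ m) ^ l - ((sq2 (ptil N a₁ a₂ τ₀ m) ^ l : ℝ) : ℂ)‖
      ≤ 2 * l * 4 ^ l * k ^ (-δ) * ε
        * (1 + k ^ (-2 * (l : ℝ)) * sq2 (ptil N a₁ a₂ τ₀ m) ^ l) := by
  have hk0 : 0 < k := by linarith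
  have hl1 : (1 : ℝ) ≤ l := by exact_mod_cast Nat.one_le_iff_ne_zero.2 hl
  have hle : k ^ (-2 * (l : ℝ) + 1 - δ) ≤ 1 :=
    Real.rpow_le_one_of_one_le_of_nonpos hk.le (by linarith)
  have hθ : cnorm (τ - cx τ₀) ≤ k := by
    have := Real.rpow_nonneg hk0.le (-2 * (l : ℝ) + 1 - δ)
    nlinarith
  have h1 := norm_nsq_pow_sub_sq2_pow_le (ptil N a₁ a₂ τ₀ m) (τ - cx τ₀) hl hθ
  rw [← ptilC_eq] at h1
  have hx0 : 0 ≤ sq2 (ptil N a₁ a₂ τ₀ m) := by rw [sq2]; positivity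
  refine le_of_mul_le_mul_left (h1.trans ?_) hk0
  have e1 : k ^ (-2 * (l : ℝ) + 1 - δ) = k * k ^ (-δ) * k ^ (-2 * (l : ℝ)) := by
    rw [show -2 * (l : ℝ) + 1 - δ = 1 + -δ + -2 * l by ring, Real.rpow_add hk0,
      Real.rpow_add hk0, Real.rpow_one]
  have e2 : k ^ (-2 * (l : ℝ)) * k ^ (2 * l) = 1 := by
    rw [← Real.rpow_natCast, ← Real.rpow_add hk0]
    push_cast
    rw [show -2 * (l : ℝ) + 2 * l = 0 by ring, Real.rpow_zero]
  rw [e1] at hτ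
  calc _ ≤ 2 * l * 4 ^ l * (ε * (k * k ^ (-δ) * k ^ (-2 * (l : ℝ))))
        * (sq2 (ptil N a₁ a₂ τ₀ m) ^ l + k ^ (2 * l)) := by gcongr
    _ = _ := by linear_combination 2 * l * 4 ^ l * ε * k * k ^ (-δ) * e2

theorem relative_perturbation_smallness {κ ε s C A : ℝ} {z : ℂ} (hκ : 0 ≤ κ) (hε0 : 0 < ε)
    (hε : ε ≤ 1) (hs0 : 0 ≤ s) (hs : s ≤ 1) (hsA : s * A ≤ 1) (hC : 0 ≤ C) (hz : ‖z‖ ≤ A + 1)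
    (h : κ * (2 * (4 + C) + 1) ≤ 1 / 2) :
    κ * ε * ((ε / 2)⁻¹ + s * (1 + (C + ‖z‖ + 1) * (ε / 2)⁻¹)) ≤ 1 / 2 := by
  have e : κ * ε * ((ε / 2)⁻¹ + s * (1 + (C + ‖z‖ + 1) * (ε / 2)⁻¹))
      = κ * (2 + s * ε + 2 * (s * (C + ‖z‖ + 1))) := by
    field_simp
    ring
  rw [e]
  refine le_trans (mul_le_mul_of_nonneg_left ?_ hκ) h
  have h1 : s * ‖z‖ ≤ s * (A + 1) := mul_le_mul_of_nonneg_left hz hs0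
  have h2 : s * C ≤ C := mul_le_of_le_one_left hC hs
  have h3 : s * ε ≤ 1 := mul_le_one₀ hs hε0.le hε
  nlinarith

theorem notEigenvalue_of_not_isEigenvalue {d : ℤ × ℤ → ℝ} {M : ℤ × ℤ → ℂ}
    {T : lp (fun _ : ℤ × ℤ => ℂ) 2 →L[ℂ] lp (fun _ : ℤ × ℤ => ℂ) 2}
    (hT : ∀ f m, HasSum (fun q => M (m - q) * f q) (T f m)) {z : ℂ}
    (h : ¬ IsEigenvalue (fun m => (d m : ℂ)) M z) : NotEigenvalue d T z := by
  intro f hf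
  by_contra hf0
  refine h ⟨f, ⟨lp.memℓp f, fun m => (hT f m).summable.norm, fun m => ?_⟩, fun h0 => hf0 ?_⟩
  · rw [(hT f m).tsum_eq, hf m]
  · exact lp.ext h0

theorem exists_threshold (l : ℕ) {δ : ℝ} (hδ : 0 < δ) (C : ℝ) :
    ∃ k₀ : ℝ, ∀ k : ℝ, k₀ < k → 2 * l * 4 ^ l * k ^ (-δ) * (2 * (4 + C) + 1) ≤ 1 / 2 := by
  have h := ((tendsto_rpow_neg_atTop hδ).const_mul (2 * l * 4 ^ l : ℝ)).mul_const
    (2 * (4 + C) + 1)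
  rw [mul_zero, zero_mul] at h
  obtain ⟨k₀, hk₀⟩ := Filter.eventually_atTop.1
    (h.eventually_le_const (by norm_num : (0 : ℝ) < 1 / 2))
  exact ⟨k₀, fun k hk => hk₀ k hk.le⟩

/-- Corollary 3.3: resolvent bound on the contour `C₂` near the second nonresonance set. -/
theorem statement8 (l : ℕ) (hl : 6 ≤ l) (δ η b₁ b₂ C_W : ℝ)
    (hδ : 0 < δ) (hδ7 : 7 * δ < 2 * (l : ℝ) - 11 - 16 * s1 l)
    (hη : 2 + 2 / s1 l < η)
    (hb₁ : 0 < b₁) (hb₂ : 0 < b₂) :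
    ∃ k₀ : ℝ, ∀ k : ℝ, k₀ < k → 1 < k →
    ∀ a₁ a₂ : ℝ,
      k ^ s1 l * b₁ / 4 ≤ a₁ → a₁ ≤ k ^ s1 l * b₁ →
      k ^ s1 l * b₂ / 4 ≤ a₂ → a₂ ≤ k ^ s1 l * b₂ →
    ∀ W : ℝ × ℝ → ℝ, Measurable W → (∀ x, |W x| ≤ C_W) →
      (∀ x, W (x + (a₁, 0)) = W x) → (∀ x, W (x + (0, a₂)) = W x) →
      (∫ x in Icc (0 : ℝ × ℝ) (a₁, a₂), W x) = 0 →
    ∀ w : ℤ × ℤ → ℂ, (∀ j, w j = fCoeff a₁ a₂ W j) →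
    ∀ N : ℕ, 0 < N →
    ∀ τ₀ : ℝ × ℝ,
      IsEigenvalue (fun m => ((sq2 (ptil N a₁ a₂ τ₀ m) ^ l : ℝ) : ℂ)) (wtil N w)
        ((k ^ (2 * (l : ℝ)) : ℝ) : ℂ) →
      (∀ lam' : ℂ,
        IsEigenvalue (fun m => ((sq2 (ptil N a₁ a₂ τ₀ m) ^ l : ℝ) : ℂ)) (wtil N w) lam' →
        lam' ≠ ((k ^ (2 * (l : ℝ)) : ℝ) : ℂ) →
        eps1 l η k < ‖lam' - ((k ^ (2 * (l : ℝ)) : ℝ) : ℂ)‖) →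
    ∀ τ : ℂ × ℂ, cnorm (τ - cx τ₀) ≤ eps1 l η k * k ^ (-2 * (l : ℝ) + 1 - δ) →
    ∀ z : ℂ, ‖z - ((k ^ (2 * (l : ℝ)) : ℝ) : ℂ)‖ = eps1 l η k / 2 →
    ∀ g : lp (fun _ : ℤ × ℤ => ℂ) 2,
      ∃ f : lp (fun _ : ℤ × ℤ => ℂ) 2,
        ((∀ m : ℤ × ℤ, Summable fun q : ℤ × ℤ => ‖wtil N w (m - q) * f q‖) ∧
          ∀ m : ℤ × ℤ,
            nsq (ptilC N a₁ a₂ τ m) ^ l * f m + (∑' q : ℤ × ℤ, wtil N w (m - q) * f q) - z * f m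
              = g m) ∧
        ‖f‖ ≤ (4 / eps1 l η k) * ‖g‖ ∧
        ∀ f' : lp (fun _ : ℤ × ℤ => ℂ) 2,
          ((∀ m : ℤ × ℤ, Summable fun q : ℤ × ℤ => ‖wtil N w (m - q) * f' q‖) ∧
            ∀ m : ℤ × ℤ,
              nsq (ptilC N a₁ a₂ τ m) ^ l * f' m + (∑' q : ℤ × ℤ, wtil N w (m - q) * f' q)
                - z * f' m = g m) →
          f' = f := by
  obtain ⟨k₀, hk₀⟩ := exists_threshold l hδ C_W
  refine ⟨k₀, fun k hkk₀ hk a₁ a₂ ha₁ _ ha₂ _ W hW hWC _ _ _ w hw N hN τ₀ _ hgap τ hτ z hz g => ?_⟩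
  have hk0 : 0 < k := by linarith
  have ha₁' : 0 < a₁ := lt_of_lt_of_le (by positivity) ha₁
  have ha₂' : 0 < a₂ := lt_of_lt_of_le (by positivity) ha₂
  have hC : 0 ≤ C_W := (abs_nonneg _).trans (hWC 0)
  have hl0 : l ≠ 0 := by omega
  obtain ⟨T, hT, hTC, hTf⟩ := exists_convolution_operator N ha₁' ha₂' hW hWC hw
  set ε := eps1 l η k with hεdef
  have hε0 : 0 < ε := Real.exp_pos _
  have hε1 : ε ≤ 1 := by
    rw [hεdef, eps1, Real.exp_le_one_iff]
    have := Real.rpow_nonneg hk0.le (η * s1 l)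
    linarith
  set κ : ℝ := 2 * l * 4 ^ l * k ^ (-δ) with hκdef
  have hκ0 : 0 ≤ κ := by positivity
  have hsmall : κ * (2 * (4 + C_W) + 1) ≤ 1 / 2 := hk₀ k hkk₀
  set K : ℂ := ((k ^ (2 * (l : ℝ)) : ℝ) : ℂ) with hK
  have hnot : ∀ lam : ℂ, lam ≠ K → ‖lam - K‖ ≤ ε →
      NotEigenvalue (fun m => sq2 (ptil N a₁ a₂ τ₀ m) ^ l) T lam := fun lam h1 h2 =>
    notEigenvalue_of_not_isEigenvalue hTf fun h3 => (hgap lam h3 h1).not_ge h2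
  have hconjK : starRingEnd ℂ K = K := Complex.conj_ofReal _
  have hsK : k ^ (-2 * (l : ℝ)) * k ^ (2 * (l : ℝ)) = 1 := by
    rw [← Real.rpow_add hk0, show -2 * (l : ℝ) + 2 * l = 0 by ring, Real.rpow_zero]
  have hz1 : ‖z‖ ≤ k ^ (2 * (l : ℝ)) + 1 := by
    have h1 : ‖z‖ ≤ ‖z - K‖ + ‖K‖ := by simpa using norm_add_le (z - K) K
    rw [hz, hK, Complex.norm_real, Real.norm_of_nonneg (Real.rpow_nonneg hk0.le _)] at h1
    linarith
  have hs1 : k ^ (-2 * (l : ℝ)) ≤ 1 :=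
    Real.rpow_le_one_of_one_le_of_nonpos hk.le
      (by have := Nat.cast_nonneg (α := ℝ) l; linarith)
  obtain ⟨f, hf, hfn, hfu⟩ := exists_unique_solution_of_relative_perturbation
    (fun m => sq2 (ptil N a₁ a₂ τ₀ m) ^ l) (fun m => by rw [sq2]; positivity)
    (tendsto_sq2_ptil_pow hN hl0 ha₁' ha₂' τ₀) T hT hTC (z := z) (ρ := ε / 2) (by positivity)
    (fun lam hlam => by
      have h1 : ‖lam - K‖ ≤ ‖lam - z‖ + ‖z - K‖ := norm_sub_le_norm_sub_add_norm_sub _ _ _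
      refine hnot lam (fun h => ?_) (by linarith)
      rw [h, norm_sub_rev, hz] at hlam
      exact lt_irrefl _ hlam)
    (by
      have h1 : ‖starRingEnd ℂ z - K‖ = ε / 2 := by
        rw [← hz, ← Complex.norm_conj (z - K), map_sub, hconjK]
      refine hnot _ (fun h => ?_) (by linarith)
      rw [h, sub_self, norm_zero] at h1
      linarith)
    (fun m => nsq (ptilC N a₁ a₂ τ m) ^ l - ((sq2 (ptil N a₁ a₂ τ₀ m) ^ l : ℝ) : ℂ))
    (κ := κ * ε) (s := k ^ (-2 * (l : ℝ))) (by positivity) (by nlinarith)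
    (Real.rpow_nonneg hk0.le _) hs1
    (fun m => norm_nsq_ptilC_pow_sub_le hl0 hδ hk hε0.le hε1 hτ m)
    (relative_perturbation_smallness hκ0 hε0 hε1 (Real.rpow_nonneg hk0.le _) hs1 hsK.le hC hz1
      hsmall) g
  simp only [add_sub_cancel] at hf hfu
  refine ⟨f, ⟨fun m => (hTf f m).summable.norm, fun m => ?_⟩, ?_, fun f' hf' => hfu f' fun m => ?_⟩
  · rw [(hTf f m).tsum_eq, hf m]
  · calc _ ≤ _ := hfn
      _ = _ := by
        congr 1
        field_simp
        norm_num
  · rw [← hf'.2 m, (hTf f' m).tsum_eq]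
end
end

section
/- (Proposition 3.10, first part: at most two quasi-intersections, and the 2l-th power equation reduces to the quadratic one.) For sufficiently large k (depending only on l, b₁, b₂) the following holds. If b₀ ≠ 0 and m ∈ ℤ² with |p_m(0)| < 4k, then the set of roots for index m lying in Φ₀ (i.e. {φ ∈ Φ₀ : |y₀(φ)+p_m(0)|²_* = k²}) contains at most two points, and moreover {φ ∈ Φ₀ : |y₀(φ)+p_m(0)|_*^{2l} = k^{2l}} = {φ ∈ Φ₀ : |y₀(φ)+p_m(0)|²_* = k²}. -/
open Real Set

noncomputable section

/-- Euclidean norm on `ℝ²`. -/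
def rn (v : ℝ × ℝ) : ℝ := Real.sqrt (sq2 v)

/-- The strip `Φ₀ = {φ : Re φ ∈ [0,2π), |Im φ| < k^{-2-4s₁}}`. -/
def Phi0 (l : ℕ) (k : ℝ) : Set ℂ :=
  {φ : ℂ | φ.re ∈ Ico 0 (2 * π) ∧ |φ.im| < k ^ (-2 - 4 * s1 l)}

/-- `y₀(φ) = (k cos φ + β₁, k sin φ + β₂)`. -/
def y0 (k : ℝ) (b : ℝ × ℝ) (φ : ℂ) : ℂ × ℂ :=
  ((k : ℂ) * Complex.cos φ + (b.1 : ℂ), (k : ℂ) * Complex.sin φ + (b.2 : ℂ))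

/-- A root for index `m`: `ψ` with `Re ψ ∈ [0,2π)` and `|y₀(ψ)+p_m(0)|²_* = k²`. -/
def IsRoot (k a₁ a₂ : ℝ) (b : ℝ × ℝ) (m : ℤ × ℤ) (ψ : ℂ) : Prop :=
  ψ.re ∈ Ico 0 (2 * π) ∧ nsq (y0 k b ψ + cx (pvec a₁ a₂ m)) = (k : ℂ) ^ 2

/-- The distance `b₀` from `b` to the nearest vertex of `K₁`. -/
def bdist (a₁ a₂ : ℝ) (b : ℝ × ℝ) : ℝ :=
  min (min (rn b) (rn (b - (2 * π / a₁, 0))))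
      (min (rn (b - (0, 2 * π / a₂))) (rn (b - (2 * π / a₁, 2 * π / a₂))))

/-- Membership in `K₁ = [0,2π/a₁) × [0,2π/a₂)`. -/
def memK1 (a₁ a₂ : ℝ) (b : ℝ × ℝ) : Prop :=
  0 ≤ b.1 ∧ b.1 < 2 * π / a₁ ∧ 0 ≤ b.2 ∧ b.2 < 2 * π / a₂

/-- A root of unity which is close enough to the nonnegative real axis equals `1`. -/
theorem exists_pos_rootOfUnity_eq_one {l : ℕ} (hl : l ≠ 0) :
    ∃ ε : ℝ, 0 < ε ∧ ∀ u : ℂ, u ^ l = 1 → ∀ r : ℝ, 0 ≤ r → ‖u - r‖ < ε → u = 1 := by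
  have hfin : {u : ℂ | u ^ l = 1}.Finite := by
    refine (Polynomial.nthRootsFinset l (1 : ℂ)).finite_toSet.subset fun u hu => ?_
    simpa [Polynomial.mem_nthRootsFinset (Nat.pos_of_ne_zero hl)] using hu
  have hev : ∀ᶠ ε : ℝ in nhdsWithin 0 (Ioi 0), ∀ u ∈ {u : ℂ | u ^ l = 1},
      ∀ r : ℝ, 0 ≤ r → ‖u - r‖ < ε → u = 1 := by
    rw [Filter.eventually_all_finite hfin]
    intro u hu
    have hnorm : ‖u‖ = 1 := Complex.norm_eq_one_of_pow_eq_one hu hl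
    by_cases him : u.im = 0
    · filter_upwards [nhdsWithin_le_nhds (Iio_mem_nhds one_pos)] with ε hε r hr h
      have hre : u = (u.re : ℂ) := Complex.ext rfl (by simpa using him)
      have habs : |u.re| = 1 := by rwa [hre, Complex.norm_real] at hnorm
      rcases (abs_eq zero_le_one).1 habs with h1 | h1
      · rw [hre, h1, Complex.ofReal_one]
      · have h2 := (Complex.abs_re_le_norm (u - r)).trans_lt (h.trans hε)
        simp only [Complex.sub_re, Complex.ofReal_re, h1] at h2
        linarith [(abs_lt.1 h2).1]
    · filter_upwards [nhdsWithin_le_nhds (Iio_mem_nhds (abs_pos.2 him))] with ε hε r hr h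
      have h2 := (Complex.abs_im_le_norm (u - r)).trans_lt (h.trans hε)
      simp at h2
  obtain ⟨ε, h, hε⟩ := (hev.and self_mem_nhdsWithin).exists
  exact ⟨ε, hε, h⟩

theorem Complex.norm_exp_mul_I_sub_le {z : ℂ} (hz : |z.im| ≤ 1) :
    ‖Complex.exp (z * Complex.I) - Complex.exp (z.re * Complex.I)‖ ≤ 2 * |z.im| := by
  have h : Complex.exp (z * Complex.I) - Complex.exp (z.re * Complex.I) =
      Complex.exp (z.re * Complex.I) * (Complex.exp (-z.im : ℝ) - 1) := by
    rw [mul_sub, ← Complex.exp_add, mul_one]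
    congr 2
    apply Complex.ext <;> simp
  rw [h, norm_mul, Complex.norm_exp_ofReal_mul_I, one_mul]
  have h2 := Complex.norm_exp_sub_one_le (x := ((-z.im : ℝ) : ℂ)) (by simpa using hz)
  simpa using h2

theorem Complex.norm_exp_neg_mul_I_sub_le {z : ℂ} (hz : |z.im| ≤ 1) :
    ‖Complex.exp (-z * Complex.I) - Complex.exp (-z.re * Complex.I)‖ ≤ 2 * |z.im| := by
  simpa using Complex.norm_exp_mul_I_sub_le (z := -z) (by simpa using hz)

theorem Complex.norm_cos_sub_cos_re_le {z : ℂ} (hz : |z.im| ≤ 1) :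
    ‖Complex.cos z - Complex.cos z.re‖ ≤ 2 * |z.im| := by
  have h : Complex.cos z - Complex.cos z.re =
      ((Complex.exp (z * Complex.I) - Complex.exp (z.re * Complex.I)) +
        (Complex.exp (-z * Complex.I) - Complex.exp (-z.re * Complex.I))) / 2 := by
    simp only [Complex.cos]; ring
  have h1 := norm_add_le_of_le (norm_exp_mul_I_sub_le hz) (norm_exp_neg_mul_I_sub_le hz)
  rw [h, norm_div, Complex.norm_two]
  linarith

theorem Complex.norm_sin_sub_sin_re_le {z : ℂ} (hz : |z.im| ≤ 1) :
    ‖Complex.sin z - Complex.sin z.re‖ ≤ 2 * |z.im| := by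
  have h : Complex.sin z - Complex.sin z.re =
      ((Complex.exp (-z * Complex.I) - Complex.exp (-z.re * Complex.I)) -
        (Complex.exp (z * Complex.I) - Complex.exp (z.re * Complex.I))) * Complex.I / 2 := by
    simp only [Complex.sin]; ring
  have h1 := norm_sub_le_of_le (norm_exp_neg_mul_I_sub_le hz) (norm_exp_mul_I_sub_le hz)
  rw [h, norm_div, norm_mul, Complex.norm_I, Complex.norm_two]
  linarith

theorem Complex.eq_of_exp_mul_I_eq {z w : ℂ} (hz : z.re ∈ Ico 0 (2 * π))
    (hw : w.re ∈ Ico 0 (2 * π))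
    (h : Complex.exp (z * Complex.I) = Complex.exp (w * Complex.I)) : z = w := by
  obtain ⟨n, hn⟩ := Complex.exp_eq_exp_iff_exists_int.1 h
  have hzw : z = w + n * (2 * π) :=
    mul_right_cancel₀ Complex.I_ne_zero (by rw [hn]; ring)
  have hre : z.re = w.re + n * (2 * π) := by
    rw [hzw]; simp
  have hn1 : (n : ℝ) < 1 := by
    by_contra! hc; nlinarith [hz.1, hz.2, hw.1, hw.2, pi_pos]
  have hn2 : (-1 : ℝ) < n := by
    by_contra! hc; nlinarith [hz.1, hz.2, hw.1, hw.2, pi_pos]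
  have hn0 : n = 0 := by
    have h1 : n < 1 := by exact_mod_cast hn1
    have h2 : -1 < n := by exact_mod_cast hn2
    omega
  simpa [hn0] using hzw

/-- A set on which an injective function takes only roots of a given quadratic polynomial as values
has at most two points. -/
theorem exists_subset_pair_of_quadratic {α K : Type*} [Inhabited α] [Field K] {S : Set α}
    {f : α → K} (hf : InjOn f S) {A B C : K} (hA : A ≠ 0)
    (h : ∀ x ∈ S, A * f x ^ 2 + B * f x + C = 0) : ∃ x y : α, S ⊆ {x, y} := by
  have hsum : ∀ x ∈ S, ∀ y ∈ S, x ≠ y → A * (f x + f y) + B = 0 := fun x hx y hy hxy =>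
    mul_left_cancel₀ (sub_ne_zero.2 fun he => hxy (hf hx hy he))
      (by linear_combination h x hx - h y hy : (f x - f y) * _ = (f x - f y) * 0)
  rcases S.subsingleton_or_nontrivial with hS | ⟨x, hx, y, hy, hxy⟩
  · rcases hS.eq_empty_or_singleton with rfl | ⟨x, rfl⟩
    · exact ⟨default, default, empty_subset _⟩
    · exact ⟨x, x, by simp⟩
  · refine ⟨x, y, fun w hw => or_iff_not_imp_left.2 fun hwx => hf hw hy ?_⟩
    exact mul_left_cancel₀ hA
      (by linear_combination hsum x hx w hw (Ne.symm hwx) - hsum x hx y hy hxy)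

theorem nsq_y0_add_cx (k : ℝ) (b p : ℝ × ℝ) (φ : ℂ) :
    nsq (y0 k b φ + cx p) = (k : ℂ) ^ 2 +
      2 * k * ((b.1 + p.1 : ℝ) * Complex.cos φ + (b.2 + p.2 : ℝ) * Complex.sin φ) +
      (sq2 (b + p) : ℝ) := by
  simp only [nsq, y0, cx, sq2, Prod.fst_add, Prod.snd_add]
  push_cast
  linear_combination (k : ℂ) ^ 2 * Complex.sin_sq_add_cos_sq φ

theorem add_pvec_ne_zero {a₁ a₂ : ℝ} (ha₁ : 0 < a₁) (ha₂ : 0 < a₂) {b : ℝ × ℝ}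
    (hb : memK1 a₁ a₂ b) (hd : bdist a₁ a₂ b ≠ 0) (m : ℤ × ℤ) : b + pvec a₁ a₂ m ≠ 0 := by
  have key : ∀ {a β : ℝ} {n : ℤ}, 0 < a → 0 ≤ β → β < 2 * π / a →
      β + 2 * π * n / a = 0 → β = 0 := by
    intro a β n ha h0 h1 h
    have hβ : β = -n * (2 * π / a) := by linear_combination h
    have hpos : 0 < 2 * π / a := by positivity
    have h2 : (-1 : ℝ) < n := by by_contra! hc; nlinarith
    have h3 : n < 1 := by
      by_contra! hc
      have : (1 : ℝ) ≤ n := by exact_mod_cast hc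
      nlinarith
    have h2 : -1 < n := by exact_mod_cast h2
    have hn : n = 0 := by omega
    simp [hβ, hn]
  intro h
  have hb0 : b = 0 := Prod.ext
    (key ha₁ hb.1 hb.2.1 (by simpa [pvec] using congrArg Prod.fst h))
    (key ha₂ hb.2.2.1 hb.2.2.2 (by simpa [pvec] using congrArg Prod.snd h))
  apply hd
  have hnn : ∀ v, 0 ≤ rn v := fun v => Real.sqrt_nonneg _
  have h0 : rn b = 0 := by simp [hb0, rn, sq2]
  unfold bdist
  rw [h0]
  simp [hnn]

theorem exists_roots_subset_pair {k : ℝ} (hk : k ≠ 0) {b p : ℝ × ℝ} (hd : b + p ≠ 0) {S : Set ℂ}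
    (hS : ∀ φ ∈ S, φ.re ∈ Ico 0 (2 * π) ∧ nsq (y0 k b φ + cx p) = (k : ℂ) ^ 2) :
    ∃ ψ₁ ψ₂ : ℂ, S ⊆ {ψ₁, ψ₂} := by
  have hk' : (k : ℂ) ≠ 0 := by exact_mod_cast hk
  refine exists_subset_pair_of_quadratic (f := fun φ => Complex.exp (φ * Complex.I))
    (A := k * ((b.1 + p.1 : ℝ) - (b.2 + p.2 : ℝ) * Complex.I)) (B := (sq2 (b + p) : ℝ))
    (C := k * ((b.1 + p.1 : ℝ) + (b.2 + p.2 : ℝ) * Complex.I))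
    (fun z hz w hw h => Complex.eq_of_exp_mul_I_eq (hS z hz).1 (hS w hw).1 h) ?_ ?_
  · refine mul_ne_zero hk' fun h => hd (Prod.ext ?_ ?_)
    · simpa using congrArg Complex.re h
    · have him := congrArg Complex.im h
      simp at him
      simpa using (by linarith : b.2 + p.2 = 0)
  · intro φ hφ
    have h := (hS φ hφ).2
    rw [nsq_y0_add_cx] at h
    have he : Complex.exp (φ * Complex.I) * Complex.exp (-φ * Complex.I) = 1 := by
      rw [← Complex.exp_add]; simp
    simp only [Complex.cos, Complex.sin] at h
    linear_combination Complex.exp (φ * Complex.I) * h -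
      k * ((b.1 + p.1 : ℝ) + (b.2 + p.2 : ℝ) * Complex.I) * he

theorem norm_nsq_y0_add_cx_sub_le {k : ℝ} (hk : 0 < k) (b p : ℝ × ℝ) {φ : ℂ} (hφ : |φ.im| ≤ 1) :
    ∃ r : ℝ, 0 ≤ r ∧ ‖nsq (y0 k b φ + cx p) - r‖ ≤
      4 * k * (|b.1 + p.1| + |b.2 + p.2|) * |φ.im| := by
  refine ⟨(k * Real.cos φ.re + b.1 + p.1) ^ 2 + (k * Real.sin φ.re + b.2 + p.2) ^ 2,
    by positivity, ?_⟩
  have h : nsq (y0 k b φ + cx p) -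
      (((k * Real.cos φ.re + b.1 + p.1) ^ 2 + (k * Real.sin φ.re + b.2 + p.2) ^ 2 : ℝ) : ℂ) =
      2 * k * ((b.1 + p.1 : ℝ) * (Complex.cos φ - Complex.cos φ.re) +
        (b.2 + p.2 : ℝ) * (Complex.sin φ - Complex.sin φ.re)) := by
    rw [nsq_y0_add_cx]
    simp only [sq2, Prod.fst_add, Prod.snd_add]
    push_cast
    linear_combination -(k : ℂ) ^ 2 * Complex.sin_sq_add_cos_sq φ.re
  have hsum : ‖((b.1 + p.1 : ℝ) : ℂ) * (Complex.cos φ - Complex.cos φ.re) +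
        ((b.2 + p.2 : ℝ) : ℂ) * (Complex.sin φ - Complex.sin φ.re)‖ ≤
      |b.1 + p.1| * (2 * |φ.im|) + |b.2 + p.2| * (2 * |φ.im|) := by
    refine norm_add_le_of_le ?_ ?_
    · rw [norm_mul, Complex.norm_real, Real.norm_eq_abs]
      gcongr
      exact Complex.norm_cos_sub_cos_re_le hφ
    · rw [norm_mul, Complex.norm_real, Real.norm_eq_abs]
      gcongr
      exact Complex.norm_sin_sub_sin_re_le hφ
  rw [h, norm_mul, norm_mul, Complex.norm_two, Complex.norm_real, Real.norm_of_nonneg hk.le]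
  calc _ ≤ 2 * k * (|b.1 + p.1| * (2 * |φ.im|) + |b.2 + p.2| * (2 * |φ.im|)) := by gcongr
    _ = _ := by ring

theorem s1_nonneg {l : ℕ} (hl : 6 ≤ l) : 0 ≤ s1 l := by
  have : (6 : ℝ) ≤ l := by exact_mod_cast hl
  unfold s1
  linarith

theorem abs_fst_le_rn (v : ℝ × ℝ) : |v.1| ≤ rn v :=
  Real.abs_le_sqrt (le_add_of_nonneg_right (sq_nonneg v.2))

theorem abs_snd_le_rn (v : ℝ × ℝ) : |v.2| ≤ rn v :=
  Real.abs_le_sqrt (le_add_of_nonneg_left (sq_nonneg v.1))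

/-- A coordinate of `b + p` is `O(k)` when `b` lies in the period cell and `|p| < 4k`. -/
theorem abs_add_le_of_period {a c k s β x : ℝ} (hk : 1 < k) (hs : 0 ≤ s) (hc : 0 < c)
    (ha : k ^ s * c / 4 ≤ a) (h0 : 0 ≤ β) (h1 : β < 2 * π / a) (hx : |x| ≤ 4 * k) :
    |β + x| ≤ (8 * π / c + 4) * k := by
  have hks : 1 ≤ k ^ s := Real.one_le_rpow hk.le hs
  have hca : c / 4 ≤ a := by nlinarith
  have hβ : β ≤ 8 * π / c := by
    calc β ≤ 2 * π / a := h1.le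
      _ ≤ 2 * π / (c / 4) := by gcongr
      _ = 8 * π / c := by field_simp; norm_num
  have hpos : 0 < 8 * π / c := by positivity
  calc |β + x| ≤ |β| + |x| := abs_add_le _ _
    _ ≤ 8 * π / c + 4 * k := by rw [abs_of_nonneg h0]; gcongr
    _ ≤ _ := by nlinarith

/-- Proposition 3.10, first part: at most two quasi-intersections for each index,
and the `2l`-th power equation reduces to the quadratic one. -/
theorem statement10 (l : ℕ) (hl : 6 ≤ l) (b₁ b₂ : ℝ) (hb₁ : 0 < b₁) (hb₂ : 0 < b₂) :
    ∃ k₀ : ℝ, ∀ k : ℝ, k₀ < k → 1 < k →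
      ∀ a₁ a₂ : ℝ,
        k ^ s1 l * b₁ / 4 ≤ a₁ → a₁ ≤ k ^ s1 l * b₁ →
        k ^ s1 l * b₂ / 4 ≤ a₂ → a₂ ≤ k ^ s1 l * b₂ →
      ∀ b : ℝ × ℝ, memK1 a₁ a₂ b → bdist a₁ a₂ b ≠ 0 →
      ∀ m : ℤ × ℤ, rn (pvec a₁ a₂ m) < 4 * k →
        (∃ ψ₁ ψ₂ : ℂ,
          {φ ∈ Phi0 l k | nsq (y0 k b φ + cx (pvec a₁ a₂ m)) = (k : ℂ) ^ 2} ⊆ {ψ₁, ψ₂}) ∧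
        {φ ∈ Phi0 l k | nsq (y0 k b φ + cx (pvec a₁ a₂ m)) ^ l = (k : ℂ) ^ (2 * l)} =
          {φ ∈ Phi0 l k | nsq (y0 k b φ + cx (pvec a₁ a₂ m)) = (k : ℂ) ^ 2} := by
  obtain ⟨ε, hε, hroot⟩ := exists_pos_rootOfUnity_eq_one (l := l) (by omega)
  set D : ℝ := (8 * π / b₁ + 4) + (8 * π / b₂ + 4) with hD
  have hDpos : 0 < D := by positivity
  refine ⟨4 * D / ε, fun k hk₀ hk a₁ a₂ ha₁ _ ha₂ _ b hb hbd m hm => ?_⟩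
  have hk0 : 0 < k := one_pos.trans hk
  have hs := s1_nonneg hl
  have hks : 0 < k ^ s1 l := Real.rpow_pos_of_pos hk0 _
  have ha₁' : 0 < a₁ := lt_of_lt_of_le (by positivity) ha₁
  have ha₂' : 0 < a₂ := lt_of_lt_of_le (by positivity) ha₂
  refine ⟨exists_roots_subset_pair hk0.ne' (add_pvec_ne_zero ha₁' ha₂' hb hbd m)
    fun φ hφ => ⟨hφ.1.1, hφ.2⟩, ?_⟩
  ext φ
  refine and_congr_right fun hφ => ⟨fun h => ?_, fun h => by rw [h, pow_mul]⟩
  have hkC : (k : ℂ) ≠ 0 := by exact_mod_cast hk0.ne'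
  have hy : |φ.im| ≤ 1 / k ^ 2 := by
    refine hφ.2.le.trans ((Real.rpow_le_rpow_of_exponent_le hk.le
      (by linarith : -2 - 4 * s1 l ≤ -2)).trans_eq ?_)
    rw [Real.rpow_neg hk0.le, one_div]
    norm_num
  have hk2 : 1 ≤ k ^ 2 := one_le_pow₀ hk.le
  obtain ⟨r, hr, hnorm⟩ := norm_nsq_y0_add_cx_sub_le hk0 b (pvec a₁ a₂ m)
    (hy.trans ((div_le_one (by positivity)).2 hk2))
  set w := nsq (y0 k b φ + cx (pvec a₁ a₂ m))
  have hd₁ := abs_add_le_of_period hk hs hb₁ ha₁ hb.1 hb.2.1 ((abs_fst_le_rn _).trans hm.le)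
  have hd₂ := abs_add_le_of_period hk hs hb₂ ha₂ hb.2.2.1 hb.2.2.2 ((abs_snd_le_rn _).trans hm.le)
  have hw : ‖w - r‖ ≤ 4 * D := by
    calc ‖w - r‖ ≤ 4 * k * ((8 * π / b₁ + 4) * k + (8 * π / b₂ + 4) * k) * (1 / k ^ 2) :=
          hnorm.trans (by gcongr)
      _ = 4 * D := by rw [hD]; field_simp
  have hu : w / (k : ℂ) ^ 2 = 1 := by
    refine hroot _ ?_ (r / k ^ 2) (by positivity) ?_
    · rw [div_pow, h, ← pow_mul, div_self (pow_ne_zero _ hkC)]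
    · have he : w / (k : ℂ) ^ 2 - (r / k ^ 2 : ℝ) = (w - r) / (k : ℂ) ^ 2 := by
        push_cast; ring
      rw [he, norm_div, norm_pow, Complex.norm_real, Real.norm_of_nonneg hk0.le,
        div_lt_iff₀ (by positivity)]
      rw [div_lt_iff₀ hε] at hk₀
      nlinarith [mul_pos hε hk0]
  exact (div_eq_one_iff_eq (pow_ne_zero 2 hkC)).1 hu
end
end

section
/- (Proposition 3.10, far modes (3.2.5.2).) For sufficiently large k (depending only on l, b₁, b₂) the following holds. For every b ∈ K₁, every m ∈ ℤ² with |p_m(0)| ≥ 4k, and every φ ∈ Φ₀: | |y₀(φ)+p_m(0)|_*^{2l} − k^{2l} | > |p_m(0)|^{2l}/2^l. In particular the equation |y₀(φ)+p_m(0)|_*^{2l} = k^{2l} has no solutions φ ∈ Φ₀. -/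
open Real Set

noncomputable section

/-- The real part of the bilinear square of `k (cos φ, sin φ) + q`, for a real vector `q`. -/
lemma re_nsq_trig_add (k q₁ q₂ : ℝ) (φ : ℂ) :
    (nsq ((k : ℂ) * Complex.cos φ + (q₁ : ℂ), (k : ℂ) * Complex.sin φ + (q₂ : ℂ))).re =
      k ^ 2 + (q₁ ^ 2 + q₂ ^ 2) +
        2 * k * Real.cosh φ.im * (Real.cos φ.re * q₁ + Real.sin φ.re * q₂) := by
  have h : nsq ((k : ℂ) * Complex.cos φ + (q₁ : ℂ), (k : ℂ) * Complex.sin φ + (q₂ : ℂ)) =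
      ((k ^ 2 + (q₁ ^ 2 + q₂ ^ 2) : ℝ) : ℂ) +
        ((2 * k * q₁ : ℝ) : ℂ) * Complex.cos φ + ((2 * k * q₂ : ℝ) : ℂ) * Complex.sin φ := by
    simp only [nsq]
    push_cast
    linear_combination (k : ℂ) ^ 2 * Complex.cos_sq_add_sin_sq φ
  have hc : (Complex.cos φ).re = Real.cos φ.re * Real.cosh φ.im := by
    rw [Complex.cos_eq, ← Complex.ofReal_cos, ← Complex.ofReal_cosh, ← Complex.ofReal_sin,
      ← Complex.ofReal_sinh]
    simp only [Complex.sub_re, Complex.mul_re, Complex.mul_im, Complex.ofReal_re,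
      Complex.ofReal_im, Complex.I_re, Complex.I_im]
    ring
  have hs : (Complex.sin φ).re = Real.sin φ.re * Real.cosh φ.im := by
    rw [Complex.sin_eq, ← Complex.ofReal_cos, ← Complex.ofReal_cosh, ← Complex.ofReal_sin,
      ← Complex.ofReal_sinh]
    simp only [Complex.add_re, Complex.mul_re, Complex.mul_im, Complex.ofReal_re,
      Complex.ofReal_im, Complex.I_re, Complex.I_im]
    ring
  rw [h, Complex.add_re, Complex.add_re, Complex.re_ofReal_mul, Complex.re_ofReal_mul, hc, hs,
    Complex.ofReal_re]
  ring

/-- Lower bound for the bilinear square in terms of the length of the real shift. -/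
lemma le_re_nsq_trig_add {k : ℝ} (hk : 0 ≤ k) (q : ℝ × ℝ) (φ : ℂ) :
    k ^ 2 + rn q ^ 2 - 2 * k * Real.cosh φ.im * rn q ≤
      (nsq ((k : ℂ) * Complex.cos φ + (q.1 : ℂ), (k : ℂ) * Complex.sin φ + (q.2 : ℂ))).re := by
  have hq : rn q ^ 2 = q.1 ^ 2 + q.2 ^ 2 := Real.sq_sqrt (by unfold sq2; positivity)
  have hcs : |Real.cos φ.re * q.1 + Real.sin φ.re * q.2| ≤ rn q := by
    refine Real.abs_le_sqrt ?_
    unfold sq2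
    nlinarith [sq_nonneg (Real.cos φ.re * q.2 - Real.sin φ.re * q.1),
      Real.sin_sq_add_cos_sq φ.re]
  have hc : 0 ≤ 2 * k * Real.cosh φ.im := by
    have := Real.cosh_pos φ.im
    positivity
  rw [re_nsq_trig_add, ← hq]
  nlinarith [mul_le_mul_of_nonneg_left (neg_le_of_abs_le hcs) hc]

/-- Removing a shift with nonnegative coordinates. -/
lemma rn_le_rn_add_add (b p : ℝ × ℝ) (h₁ : 0 ≤ b.1) (h₂ : 0 ≤ b.2) :
    rn p ≤ rn (b + p) + (b.1 + b.2) := by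
  have hQ : 0 ≤ rn (b + p) := Real.sqrt_nonneg _
  have hq : rn (b + p) ^ 2 = (b.1 + p.1) ^ 2 + (b.2 + p.2) ^ 2 :=
    Real.sq_sqrt (by unfold sq2; positivity)
  have hq₁ : |b.1 + p.1| ≤ rn (b + p) := Real.abs_le_sqrt (by
    simp only [sq2, Prod.fst_add, Prod.snd_add]; nlinarith [sq_nonneg (b.2 + p.2)])
  have hq₂ : |b.2 + p.2| ≤ rn (b + p) := Real.abs_le_sqrt (by
    simp only [sq2, Prod.fst_add, Prod.snd_add]; nlinarith [sq_nonneg (b.1 + p.1)])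
  refine Real.sqrt_le_iff.2 ⟨by positivity, ?_⟩
  unfold sq2
  nlinarith [mul_le_mul_of_nonneg_right (neg_le_of_abs_le hq₁) h₁,
    mul_le_mul_of_nonneg_right (neg_le_of_abs_le hq₂) h₂, mul_nonneg h₁ h₂]

lemma cosh_le_of_abs_le {y : ℝ} (hy : |y| ≤ 1 / 100) : Real.cosh y ≤ 1001 / 1000 := by
  have h := Real.cosh_le_exp_half_sq y
  have hy2 : y ^ 2 / 2 ≤ 1 / 20000 := by
    have := sq_le_sq' (neg_le_of_abs_le hy) (le_of_abs_le hy)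
    norm_num at this
    linarith
  have h1 := Real.one_sub_le_exp_neg (y ^ 2 / 2)
  have h2 : Real.exp (y ^ 2 / 2) * Real.exp (-(y ^ 2 / 2)) = 1 := by
    rw [← Real.exp_add, add_neg_cancel, Real.exp_zero]
  nlinarith [Real.exp_pos (y ^ 2 / 2)]

/-- A coordinate of `K₁` is bounded independently of `k`. -/
lemma two_pi_div_le {k s a c : ℝ} (hk : 1 < k) (hs : 0 ≤ s) (hc : 0 < c)
    (ha : k ^ s * c / 4 ≤ a) : 2 * π / a ≤ 8 * π / c := by
  have h1 : 1 ≤ k ^ s := Real.one_le_rpow hk.le hs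
  have hca : c / 4 ≤ a := by nlinarith
  calc 2 * π / a ≤ 2 * π / (c / 4) := by gcongr
    _ = 8 * π / c := by field_simp; norm_num

/-- Quadratic lower bound on the shifted square when the shift dominates `k`. -/
lemma quadratic_lower_bound {k P Q c : ℝ} (hk : 0 < k) (hP : 4 * k ≤ P)
    (hQ : 99 / 100 * P ≤ Q) (hc : c ≤ 1001 / 1000) :
    17 / 32 * P ^ 2 ≤ k ^ 2 + Q ^ 2 - 2 * k * c * Q := by
  have hQk : 396 / 100 * k ≤ Q := by linarith
  have hkQ : 0 < k * Q := mul_pos hk (by linarith)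
  have h1 : 2 * k * c * Q ≤ 2 * (1001 / 1000) * (k * Q) := by nlinarith
  have h2 : (99 / 100 * P) ^ 2 ≤ Q ^ 2 := pow_le_pow_left₀ (by linarith) hQ 2
  have h3 : 0 ≤ (Q - 396 / 100 * k) * (17 / 10 * Q) :=
    mul_nonneg (by linarith) (by linarith)
  have h4 : 0 ≤ (Q - 396 / 100 * k) * (Q - k / 4) :=
    mul_nonneg (by linarith) (by linarith)
  nlinarith

/-- Passing from the lower bound on the square to its `l`-th power. -/
lemma pow_div_lt_sub {l : ℕ} (hl : 6 ≤ l) {k P N : ℝ} (hk : 0 < k) (hP : 4 * k ≤ P)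
    (hN : 17 / 32 * P ^ 2 ≤ N) : P ^ (2 * l) / 2 ^ l < N ^ l - k ^ (2 * l) := by
  have hP0 : 0 < P := by linarith
  have h1 : (17 / 32 * P ^ 2) ^ l ≤ N ^ l := pow_le_pow_left₀ (by positivity) hN l
  have h2 : (k ^ 2) ^ l ≤ (1 / 8 * (1 / 2 * P ^ 2)) ^ l :=
    pow_le_pow_left₀ (by positivity) (by nlinarith) l
  have h3 : (1 / 8 : ℝ) ^ l ≤ 1 / 8 := by
    simpa using pow_le_pow_of_le_one (by norm_num : (0 : ℝ) ≤ 1 / 8) (by norm_num)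
      (by omega : 1 ≤ l)
  have h4 : 1 + (l : ℝ) * (1 / 16) ≤ (1 + 1 / 16) ^ l :=
    one_add_mul_le_pow (by norm_num) l
  have hl' : (6 : ℝ) ≤ l := by exact_mod_cast hl
  have h5 : (17 / 32 * P ^ 2) ^ l = (1 + 1 / 16) ^ l * (1 / 2 * P ^ 2) ^ l := by
    rw [← mul_pow]; congr 1; ring
  have h6 : P ^ (2 * l) / 2 ^ l = (1 / 2 * P ^ 2) ^ l := by
    rw [pow_mul, ← div_pow]; congr 1; ring
  have hX : 0 < (1 / 2 * P ^ 2) ^ l := by positivity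
  rw [h5] at h1
  rw [mul_pow] at h2
  rw [h6, pow_mul]
  nlinarith

/-- Proposition 3.10, far modes (3.2.5.2). -/
theorem statement12 (l : ℕ) (hl : 6 ≤ l) (b₁ b₂ : ℝ) (hb₁ : 0 < b₁) (hb₂ : 0 < b₂) :
    ∃ k₀ : ℝ, ∀ k : ℝ, k₀ < k → 1 < k →
      ∀ a₁ a₂ : ℝ,
        k ^ s1 l * b₁ / 4 ≤ a₁ → a₁ ≤ k ^ s1 l * b₁ →
        k ^ s1 l * b₂ / 4 ≤ a₂ → a₂ ≤ k ^ s1 l * b₂ →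
      ∀ b : ℝ × ℝ, memK1 a₁ a₂ b →
      ∀ m : ℤ × ℤ, 4 * k ≤ rn (pvec a₁ a₂ m) →
      ∀ φ ∈ Phi0 l k,
        rn (pvec a₁ a₂ m) ^ (2 * l) / 2 ^ l <
            ‖nsq (y0 k b φ + cx (pvec a₁ a₂ m)) ^ l - (k : ℂ) ^ (2 * l)‖ ∧
          nsq (y0 k b φ + cx (pvec a₁ a₂ m)) ^ l ≠ (k : ℂ) ^ (2 * l) := by
  refine ⟨max 100 (25 * (8 * π / b₁ + 8 * π / b₂)), ?_⟩
  intro k hk₀ hk a₁ a₂ ha₁ _ ha₂ _ b hb m hm φ hφ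
  obtain ⟨hb1, hb1', hb2, hb2'⟩ := hb
  have hk100 : 100 < k := (le_max_left _ _).trans_lt hk₀
  have hkC : 25 * (8 * π / b₁ + 8 * π / b₂) < k := (le_max_right _ _).trans_lt hk₀
  have hk0 : 0 < k := by linarith
  have hs : 0 ≤ s1 l := by
    have : (6 : ℝ) ≤ l := by exact_mod_cast hl
    unfold s1
    linarith
  have hB₁ := two_pi_div_le hk hs hb₁ ha₁
  have hB₂ := two_pi_div_le hk hs hb₂ ha₂
  set p := pvec a₁ a₂ m with hp
  have hQ : 99 / 100 * rn p ≤ rn (b + p) := by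
    have := rn_le_rn_add_add b p hb1 hb2
    linarith
  have hcosh : Real.cosh φ.im ≤ 1001 / 1000 := by
    refine cosh_le_of_abs_le (hφ.2.le.trans ?_)
    calc k ^ (-2 - 4 * s1 l) ≤ k ^ (-1 : ℝ) :=
          Real.rpow_le_rpow_of_exponent_le hk.le (by linarith)
      _ = 1 / k := by rw [Real.rpow_neg_one, one_div]
      _ ≤ 1 / 100 := by gcongr
  have hy : y0 k b φ + cx p = ((k : ℂ) * Complex.cos φ + ((b + p).1 : ℂ),
      (k : ℂ) * Complex.sin φ + ((b + p).2 : ℂ)) := by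
    simp [y0, cx, add_assoc]
  have hN : 17 / 32 * rn p ^ 2 ≤ ‖nsq (y0 k b φ + cx p)‖ := by
    refine (quadratic_lower_bound hk0 hm hQ hcosh).trans ?_
    rw [hy]
    exact (le_re_nsq_trig_add hk0.le (b + p) φ).trans (Complex.re_le_norm _)
  have hmain : rn p ^ (2 * l) / 2 ^ l <
      ‖nsq (y0 k b φ + cx p) ^ l - (k : ℂ) ^ (2 * l)‖ := by
    refine (pow_div_lt_sub hl hk0 hm hN).trans_le ?_
    have h := norm_sub_norm_le (nsq (y0 k b φ + cx p) ^ l) ((k : ℂ) ^ (2 * l))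
    rwa [norm_pow, norm_pow, Complex.norm_of_nonneg hk0.le] at h
  refine ⟨hmain, fun h => ?_⟩
  rw [h, sub_self, norm_zero] at hmain
  have : 0 ≤ rn p ^ (2 * l) / 2 ^ l := by
    have : 0 ≤ rn p := Real.sqrt_nonneg _
    positivity
  linarith
end
end

section
/- (Corollary to Proposition 3.10: bound on the number of quasi-intersections.) For sufficiently large k (depending only on l, b₁, b₂) the following holds. For every b ∈ K₁ with b₀ ≠ 0, the set {φ ∈ Φ₀ : there exists m ∈ ℤ² with |y₀(φ)+p_m(0)|_*^{2l} = k^{2l}} is finite and has at most 32·b₁·b₂·k^{2+2s₁} elements. -/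
open Real Set

noncomputable section

theorem norm_pow_sub_one_le {ω : ℂ} (hω : ‖ω‖ = 1) (n : ℕ) : ‖ω ^ n - 1‖ ≤ n * ‖ω - 1‖ := by
  induction n with
  | zero => simp
  | succ n ih =>
    have h : ω ^ (n + 1) - 1 = ω * (ω ^ n - 1) + (ω - 1) := by ring
    calc ‖ω ^ (n + 1) - 1‖ ≤ ‖ω * (ω ^ n - 1)‖ + ‖ω - 1‖ := by rw [h]; exact norm_add_le _ _
      _ = ‖ω ^ n - 1‖ + ‖ω - 1‖ := by rw [norm_mul, hω, one_mul]
      _ ≤ ((n + 1 : ℕ) : ℝ) * ‖ω - 1‖ := by push_cast; linarith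

/-- An `l`-th root of unity at distance less than `1 / l` from `1` equals `1`. -/
theorem eq_one_of_pow_eq_one_of_near {ω : ℂ} {l : ℕ} (hl : l ≠ 0) (h : ω ^ l = 1)
    (hn : l * ‖ω - 1‖ < 1) : ω = 1 := by
  by_contra hne
  have hω : ‖ω‖ = 1 := Complex.norm_eq_one_of_pow_eq_one h hl
  have hs : ∑ i ∈ Finset.range l, ω ^ i = 0 := by
    have := geom_sum_mul ω l
    rw [h, sub_self] at this
    exact (mul_eq_zero.mp this).resolve_right (sub_ne_zero.mpr hne)
  have h1 : ∑ i ∈ Finset.range l, (ω ^ i - 1) = -(l : ℂ) := by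
    rw [Finset.sum_sub_distrib, hs]; simp
  have h2 : (l : ℝ) ≤ ∑ _i ∈ Finset.range l, (l : ℝ) * ‖ω - 1‖ := by
    calc (l : ℝ) = ‖∑ i ∈ Finset.range l, (ω ^ i - 1)‖ := by rw [h1]; simp
      _ ≤ ∑ i ∈ Finset.range l, ‖ω ^ i - 1‖ := norm_sum_le _ _
      _ ≤ _ := by
        refine Finset.sum_le_sum fun i hi => (norm_pow_sub_one_le hω i).trans ?_
        have : (i : ℝ) ≤ l := by exact_mod_cast (Finset.mem_range.mp hi).le
        gcongr
  have hl' : (0 : ℝ) < l := by exact_mod_cast Nat.pos_of_ne_zero hl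
  simp only [Finset.sum_const, Finset.card_range, nsmul_eq_mul] at h2
  nlinarith

theorem abs_sinh_le_two_mul_abs {y : ℝ} (hy : |y| ≤ 1) : |sinh y| ≤ 2 * |y| := by
  have h1 := Real.abs_exp_sub_one_le hy
  have h2 := Real.abs_exp_sub_one_le (x := -y) (by rwa [abs_neg])
  rw [abs_neg] at h2
  rw [Real.sinh_eq]
  rw [abs_le] at *
  constructor <;> linarith

theorem nsq_y0_add_re (k : ℝ) (b v : ℝ × ℝ) (φ : ℂ) :
    (nsq (y0 k b φ + cx v)).re =
      k ^ 2 + 2 * k * cosh φ.im * ((b.1 + v.1) * cos φ.re + (b.2 + v.2) * sin φ.re)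
        + ((b.1 + v.1) ^ 2 + (b.2 + v.2) ^ 2) := by
  have h1 := Real.sin_sq_add_cos_sq φ.re
  have h2 := Real.cosh_sq φ.im
  simp only [nsq, y0, cx, Prod.fst_add, Prod.snd_add]
  rw [Complex.cos_eq φ, Complex.sin_eq φ]
  simp only [← Complex.ofReal_cos, ← Complex.ofReal_sin, ← Complex.ofReal_cosh,
    ← Complex.ofReal_sinh]
  simp [pow_two, -Complex.ofReal_cos, -Complex.ofReal_sin, -Complex.ofReal_cosh,
    -Complex.ofReal_sinh]
  linear_combination (k ^ 2 * (cosh φ.im ^ 2 - sinh φ.im ^ 2)) * h1 + k ^ 2 * h2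

theorem nsq_y0_add_im (k : ℝ) (b v : ℝ × ℝ) (φ : ℂ) :
    (nsq (y0 k b φ + cx v)).im =
      2 * k * sinh φ.im * ((b.2 + v.2) * cos φ.re - (b.1 + v.1) * sin φ.re) := by
  simp only [nsq, y0, cx, Prod.fst_add, Prod.snd_add]
  rw [Complex.cos_eq φ, Complex.sin_eq φ]
  simp only [← Complex.ofReal_cos, ← Complex.ofReal_sin, ← Complex.ofReal_cosh,
    ← Complex.ofReal_sinh]
  simp [pow_two, -Complex.ofReal_cos, -Complex.ofReal_sin, -Complex.ofReal_cosh,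
    -Complex.ofReal_sinh]
  ring

/-- Real estimates behind `nsq_eq_of_nsq_pow_eq`: `x + iy` is a unit complex number, and `p` is the
length of a real vector. -/
theorem unit_vector_estimates {k p x y A B C S : ℝ} (hk : 0 < k)
    (hC1 : 1 ≤ C) (hCC : C ^ 2 = S ^ 2 + 1) (hS : |S| ≤ 1 / 300)
    (hA : |A| ≤ p) (hB : |B| ≤ p) (hnorm : x ^ 2 + y ^ 2 = 1)
    (hre : k ^ 2 * x = k ^ 2 + 2 * k * C * A + p ^ 2) (him : k ^ 2 * y = 2 * k * S * B) :
    p ≤ 4 * k ∧ (x - 1) ^ 2 + y ^ 2 ≤ (12 * |S|) ^ 2 := by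
  have hSS : S ^ 2 ≤ (1 / 300) ^ 2 := by rw [← sq_abs]; gcongr
  have hC2 : C ≤ 2 := by nlinarith
  have hre1 : x ≤ 1 := by nlinarith [sq_nonneg y]
  have hAl := (abs_le.mp hA).1
  have hkCA : -(2 * k * C * p) ≤ 2 * k * C * A := by
    have h0 : 0 < 2 * k * C := by positivity
    calc -(2 * k * C * p) = 2 * k * C * (-p) := by ring
      _ ≤ _ := mul_le_mul_of_nonneg_left hAl h0.le
  have hp4 : p ≤ 4 * k := by
    have h1 : k ^ 2 * x ≤ k ^ 2 := mul_le_of_le_one_right (by positivity) hre1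
    by_contra! hcon
    have h2 : p * p ≤ 2 * k * C * p := by linarith
    have h3 : p ≤ 2 * k * C := le_of_mul_le_mul_right h2 (by linarith)
    have h4 : k * C ≤ k * 2 := mul_le_mul_of_nonneg_left hC2 hk.le
    linarith
  refine ⟨hp4, ?_⟩
  have hrelow : -S ^ 2 ≤ x := by
    have h1 : k ^ 2 * (-S ^ 2) ≤ k ^ 2 * x := by
      have h2 := sq_nonneg (p - k * C)
      have h3 : k ^ 2 * C ^ 2 = k ^ 2 * S ^ 2 + k ^ 2 := by rw [hCC]; ring
      linarith
    exact le_of_mul_le_mul_left h1 (by positivity)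
  have himb : |y| ≤ 8 * |S| := by
    have h1 : k ^ 2 * |y| = 2 * k * |S| * |B| := by
      have := congrArg abs him
      rw [abs_mul, abs_mul, abs_mul, abs_of_pos (by positivity : (0:ℝ) < k ^ 2),
        abs_of_pos (by positivity : (0:ℝ) < 2 * k)] at this
      exact this
    have h2 : 2 * k * |S| * |B| ≤ 2 * k * |S| * (4 * k) := by
      gcongr; linarith
    have h3 : k ^ 2 * |y| ≤ k ^ 2 * (8 * |S|) := by linarith
    exact le_of_mul_le_mul_left h3 (by positivity)
  have him2 : y ^ 2 ≤ 64 * S ^ 2 := by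
    rw [← sq_abs, ← sq_abs S]
    calc |y| ^ 2 ≤ (8 * |S|) ^ 2 := by gcongr
      _ = _ := by ring
  have hre0 : 0 ≤ x := by nlinarith
  rw [mul_pow, sq_abs]
  nlinarith

/-- Close to the real axis, `|y₀(φ) + v|_*^{2l} = k^{2l}` forces `|y₀(φ) + v|_*² = k²` and
`|b + v| ≤ 4k`. -/
theorem nsq_eq_of_nsq_pow_eq {l : ℕ} (hl : 6 ≤ l) {k : ℝ} (hk : 0 < k) (b v : ℝ × ℝ) {φ : ℂ}
    (hs : l * |sinh φ.im| ≤ 1 / 50)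
    (h : nsq (y0 k b φ + cx v) ^ l = (k : ℂ) ^ (2 * l)) :
    nsq (y0 k b φ + cx v) = (k : ℂ) ^ 2 ∧
      (b.1 + v.1) ^ 2 + (b.2 + v.2) ^ 2 ≤ (4 * k) ^ 2 := by
  have hre := nsq_y0_add_re k b v φ
  have him := nsq_y0_add_im k b v φ
  generalize nsq (y0 k b φ + cx v) = w at h hre him ⊢
  generalize b.1 + v.1 = u₁ at hre him ⊢
  generalize b.2 + v.2 = u₂ at hre him ⊢
  have hpp : √(u₁ ^ 2 + u₂ ^ 2) ^ 2 = u₁ ^ 2 + u₂ ^ 2 := Real.sq_sqrt (by positivity)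
  have htrig := Real.sin_sq_add_cos_sq φ.re
  have hl6 : (6 : ℝ) ≤ l := by exact_mod_cast hl
  have hS300 : |sinh φ.im| ≤ 1 / 300 := by nlinarith [abs_nonneg (sinh φ.im)]
  have hA : |u₁ * cos φ.re + u₂ * sin φ.re| ≤ √(u₁ ^ 2 + u₂ ^ 2) := by
    apply Real.abs_le_sqrt
    have := sq_nonneg (u₁ * sin φ.re - u₂ * cos φ.re)
    linear_combination this + (u₁ ^ 2 + u₂ ^ 2) * htrig
  have hB : |u₂ * cos φ.re - u₁ * sin φ.re| ≤ √(u₁ ^ 2 + u₂ ^ 2) := by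
    apply Real.abs_le_sqrt
    have := sq_nonneg (u₁ * cos φ.re + u₂ * sin φ.re)
    linear_combination this + (u₁ ^ 2 + u₂ ^ 2) * htrig
  have hl0 : l ≠ 0 := by omega
  have hkC : (k : ℂ) ^ 2 ≠ 0 := pow_ne_zero _ (by exact_mod_cast hk.ne')
  obtain ⟨ω, rfl⟩ : ∃ ω, w = ((k ^ 2 : ℝ) : ℂ) * ω :=
    ⟨w / (k : ℂ) ^ 2, by push_cast; rw [mul_div_cancel₀ _ hkC]⟩
  have hωl : ω ^ l = 1 := by
    push_cast at h
    rw [mul_pow, ← pow_mul] at h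
    exact mul_eq_left₀ (by rw [pow_mul]; exact pow_ne_zero _ hkC) |>.mp h
  rw [Complex.re_ofReal_mul, ← hpp] at hre
  rw [Complex.im_ofReal_mul] at him
  have hnorm : ω.re ^ 2 + ω.im ^ 2 = 1 := by
    have := Complex.sq_norm ω
    rw [Complex.norm_eq_one_of_pow_eq_one hωl hl0, Complex.normSq_apply] at this
    linarith
  obtain ⟨hp, hd⟩ := unit_vector_estimates hk (Real.one_le_cosh φ.im)
    (Real.cosh_sq _) hS300 hA hB hnorm hre him
  refine ⟨?_, by rw [← hpp]; gcongr⟩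
  have hdist : ‖ω - 1‖ ≤ 12 * |sinh φ.im| := by
    refine le_of_sq_le_sq ?_ (by positivity)
    rw [Complex.sq_norm, Complex.normSq_apply]
    simp only [Complex.sub_re, Complex.sub_im, Complex.one_re, Complex.one_im]
    linarith
  have h1 : ω = 1 := by
    apply eq_one_of_pow_eq_one_of_near hl0 hωl
    calc (l : ℝ) * ‖ω - 1‖ ≤ l * (12 * |sinh φ.im|) := by gcongr
      _ < 1 := by linarith
  rw [h1]; push_cast; ring

theorem cexp_I_mul_injOn : InjOn (fun φ : ℂ => Complex.exp (Complex.I * φ))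
    {φ : ℂ | φ.re ∈ Ico 0 (2 * π)} := by
  intro φ hφ ψ hψ h
  obtain ⟨n, hn⟩ := Complex.exp_eq_exp_iff_exists_int.mp h
  have h1 : φ = ψ + ((n * (2 * π) : ℝ) : ℂ) := by
    apply mul_left_cancel₀ Complex.I_ne_zero
    rw [hn]; push_cast; ring
  have h2 : φ.re = ψ.re + n * (2 * π) := by
    rw [h1, Complex.add_re, Complex.ofReal_re]
  obtain ⟨h3, h4⟩ := hφ
  obtain ⟨h5, h6⟩ := hψ
  have hpi := Real.pi_pos
  have h7 : (n : ℝ) < 1 := by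
    by_contra! hc
    nlinarith
  have h8 : (-1 : ℝ) < n := by
    by_contra! hc
    nlinarith
  have h9 : n = 0 := by
    have : n < 1 := by exact_mod_cast h7
    have : -1 < n := by exact_mod_cast h8
    omega
  rw [h1, h9]; simp

theorem quadratic_roots_subset {a b c z₁ : ℂ} (ha : a ≠ 0) (h₁ : a * z₁ ^ 2 + b * z₁ + c = 0) :
    {z : ℂ | a * z ^ 2 + b * z + c = 0} ⊆ {z₁, -b / a - z₁} := by
  intro z hz
  have hz : a * z ^ 2 + b * z + c = 0 := hz
  have h : (z - z₁) * (a * (z + z₁) + b) = 0 := by linear_combination hz - h₁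
  rcases mul_eq_zero.mp h with h | h
  · left; exact sub_eq_zero.mp h
  · right
    rw [mem_singleton_iff]
    field_simp
    linear_combination h

theorem quadratic_roots_finite_ncard_le {a b c : ℂ} (ha : a ≠ 0) :
    {z : ℂ | a * z ^ 2 + b * z + c = 0}.Finite ∧
      {z : ℂ | a * z ^ 2 + b * z + c = 0}.ncard ≤ 2 := by
  rcases Set.eq_empty_or_nonempty {z : ℂ | a * z ^ 2 + b * z + c = 0} with h | ⟨z₁, h₁⟩
  · rw [h]; simp
  · have hsub := quadratic_roots_subset ha h₁
    exact ⟨(Set.toFinite _).subset hsub,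
      (Set.ncard_le_ncard hsub (Set.toFinite _)).trans ((Set.ncard_insert_le _ _).trans (by simp))⟩

/-- For `b + v ≠ 0` the equation `|y₀(φ) + v|_*² = k²` has at most two solutions modulo `2π`. -/
theorem finite_ncard_nsq_eq_le {k : ℝ} (hk : 0 < k) (b v : ℝ × ℝ) (hv : b + v ≠ 0) :
    {φ : ℂ | φ.re ∈ Ico 0 (2 * π) ∧ nsq (y0 k b φ + cx v) = (k : ℂ) ^ 2}.Finite ∧
      {φ : ℂ | φ.re ∈ Ico 0 (2 * π) ∧ nsq (y0 k b φ + cx v) = (k : ℂ) ^ 2}.ncard ≤ 2 := by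
  set u₁ := b.1 + v.1 with hu₁
  set u₂ := b.2 + v.2 with hu₂
  set a : ℂ := k * ((u₁ : ℂ) - u₂ * Complex.I) with ha
  set c : ℂ := k * ((u₁ : ℂ) + u₂ * Complex.I) with hc
  set d : ℂ := (u₁ : ℂ) ^ 2 + (u₂ : ℂ) ^ 2 with hd
  have hkC : (k : ℂ) ≠ 0 := by exact_mod_cast hk.ne'
  have ha0 : a ≠ 0 := by
    refine mul_ne_zero hkC fun h0 => hv ?_
    have h1 := congrArg Complex.re h0
    have h2 := congrArg Complex.im h0
    simp at h1 h2
    exact Prod.ext h1 h2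
  obtain ⟨hfin, hcard⟩ := quadratic_roots_finite_ncard_le (b := d) (c := c) ha0
  have hmaps : MapsTo (fun φ : ℂ => Complex.exp (Complex.I * φ))
      {φ : ℂ | φ.re ∈ Ico 0 (2 * π) ∧ nsq (y0 k b φ + cx v) = (k : ℂ) ^ 2}
      {z : ℂ | a * z ^ 2 + d * z + c = 0} := by
    rintro φ ⟨-, hφ⟩
    have hcos : Complex.cos φ =
        (Complex.exp (Complex.I * φ) + (Complex.exp (Complex.I * φ))⁻¹) / 2 := by
      rw [← Complex.exp_neg, Complex.cos]; ring_nf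
    have hsin : Complex.sin φ =
        ((Complex.exp (Complex.I * φ))⁻¹ - Complex.exp (Complex.I * φ)) * Complex.I / 2 := by
      rw [← Complex.exp_neg, Complex.sin]; ring_nf
    have hz := Complex.exp_ne_zero (Complex.I * φ)
    have hI := Complex.I_sq
    have hsc := Complex.sin_sq_add_cos_sq φ
    have hlin : 2 * (k : ℂ) * (u₁ * Complex.cos φ + u₂ * Complex.sin φ) + d = 0 := by
      simp only [nsq, y0, cx, Prod.fst_add, Prod.snd_add] at hφ
      rw [hd, hu₁, hu₂]
      push_cast
      linear_combination hφ - (k : ℂ) ^ 2 * hsc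
    rw [hcos, hsin] at hlin
    set z := Complex.exp (Complex.I * φ)
    have hmul : z * z⁻¹ = 1 := mul_inv_cancel₀ hz
    change a * z ^ 2 + d * z + c = 0
    rw [ha, hc]
    linear_combination z * hlin - (k * u₁ + k * u₂ * Complex.I) * hmul
  have hinj := cexp_I_mul_injOn.mono
    (fun φ (hφ : φ ∈ {φ : ℂ | φ.re ∈ Ico 0 (2 * π) ∧ nsq (y0 k b φ + cx v) = (k : ℂ) ^ 2}) => hφ.1)
  exact ⟨Set.Finite.of_injOn hmaps hinj hfin,
    (Set.ncard_le_ncard_of_injOn _ hmaps hinj hfin).trans hcard⟩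

theorem int_eq_zero_of_add_eq_zero {a β : ℝ} (ha : 0 < a) (h0 : 0 ≤ β) (h1 : β < 2 * π / a)
    {n : ℤ} (h : β + 2 * π * n / a = 0) : β = 0 := by
  have hc : 0 < 2 * π / a := by positivity
  have h2 : β + (2 * π / a) * n = 0 := by rw [← h]; ring
  have h3 : (n : ℝ) < 1 := by
    by_contra! hcon
    nlinarith
  have h4 : (-1 : ℝ) < n := by
    by_contra! hcon
    nlinarith
  have h5 : n = 0 := by
    have : n < 1 := by exact_mod_cast h3
    have : -1 < n := by exact_mod_cast h4
    omega
  rw [h5] at h2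
  simpa using h2

/-- The integers `n` with `|β + 2πn/a| ≤ 4k` lie in an interval with at most `4ka` points. -/
theorem exists_finset_int {k a β : ℝ} (ha : 0 < a) (hka : 2 ≤ k * a)
    (h0 : 0 ≤ β) (h1 : β < 2 * π / a) :
    ∃ F : Finset ℤ, (∀ n : ℤ, |β + 2 * π * n / a| ≤ 4 * k → n ∈ F) ∧
      (F.card : ℝ) ≤ 4 * (k * a) := by
  have hpi := Real.pi_gt_three
  refine ⟨Finset.Icc (-⌊2 / 3 * (k * a) + 1⌋) ⌊2 / 3 * (k * a) + 1⌋, fun n hn => ?_, ?_⟩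
  · rw [abs_le] at hn
    have hβ : β * a < 2 * π := (lt_div_iff₀ ha).mp h1
    have hβ0 : 0 ≤ β * a := by positivity
    have hval : (β + 2 * π * n / a) * a = β * a + 2 * π * n := by field_simp
    have hup : β * a + 2 * π * n ≤ 4 * k * a := by
      rw [← hval]; exact mul_le_mul_of_nonneg_right hn.2 ha.le
    have hlo : -(4 * k * a) ≤ β * a + 2 * π * n := by
      rw [← hval, ← neg_mul]; exact mul_le_mul_of_nonneg_right hn.1 ha.le
    have hX : 6 * (2 / 3 * (k * a)) ≤ 2 * π * (2 / 3 * (k * a)) := by nlinarith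
    rw [Finset.mem_Icc, neg_le, Int.le_floor, Int.le_floor]
    push_cast
    constructor
    · by_contra! hc
      nlinarith
    · by_contra! hc
      nlinarith
  · rw [Int.card_Icc]
    have hf := Int.floor_le (2 / 3 * (k * a) + 1)
    have hf0 : 0 ≤ ⌊2 / 3 * (k * a) + 1⌋ := Int.floor_nonneg.mpr (by linarith)
    set N := ⌊2 / 3 * (k * a) + 1⌋
    have h2 : (((N + 1 - -N).toNat : ℤ) : ℝ) = 2 * N + 1 := by
      rw [Int.toNat_of_nonneg (by omega)]; push_cast; ring
    rw [Int.cast_natCast] at h2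
    rw [h2]
    linarith

theorem l_mul_abs_sinh_le {l : ℕ} (hl : 6 ≤ l) {k : ℝ} (hk1 : 1 < k) (hk : 100 * (l : ℝ) ≤ k)
    {φ : ℂ} (hφ : φ ∈ Phi0 l k) : l * |sinh φ.im| ≤ 1 / 50 := by
  have hl6 : (6 : ℝ) ≤ l := by exact_mod_cast hl
  have hexp : k ^ (-2 - 4 * s1 l) ≤ k⁻¹ := by
    rw [← Real.rpow_neg_one]
    apply Real.rpow_le_rpow_of_exponent_le hk1.le
    unfold s1
    linarith
  have hy : |φ.im| ≤ k⁻¹ := hφ.2.le.trans hexp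
  have hk0 : 0 < k := by linarith
  have hs := abs_sinh_le_two_mul_abs (hy.trans (inv_le_one_of_one_le₀ hk1.le))
  have h1 : (l : ℝ) * k⁻¹ ≤ 1 / 100 := by
    rw [← div_eq_mul_inv, div_le_iff₀ hk0]; linarith
  calc (l : ℝ) * |sinh φ.im| ≤ l * (2 * k⁻¹) := by gcongr; linarith
    _ ≤ 1 / 50 := by linarith

/-- Corollary to Proposition 3.10: bound on the number of quasi-intersections. -/
theorem statement13 (l : ℕ) (hl : 6 ≤ l) (b₁ b₂ : ℝ) (hb₁ : 0 < b₁) (hb₂ : 0 < b₂) :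
    ∃ k₀ : ℝ, ∀ k : ℝ, k₀ < k → 1 < k →
      ∀ a₁ a₂ : ℝ,
        k ^ s1 l * b₁ / 4 ≤ a₁ → a₁ ≤ k ^ s1 l * b₁ →
        k ^ s1 l * b₂ / 4 ≤ a₂ → a₂ ≤ k ^ s1 l * b₂ →
      ∀ b : ℝ × ℝ, memK1 a₁ a₂ b → bdist a₁ a₂ b ≠ 0 →
        {φ ∈ Phi0 l k |
            ∃ m : ℤ × ℤ, nsq (y0 k b φ + cx (pvec a₁ a₂ m)) ^ l = (k : ℂ) ^ (2 * l)}.Finite ∧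
        ({φ ∈ Phi0 l k |
            ∃ m : ℤ × ℤ, nsq (y0 k b φ + cx (pvec a₁ a₂ m)) ^ l = (k : ℂ) ^ (2 * l)}.ncard : ℝ)
          ≤ 32 * b₁ * b₂ * k ^ (2 + 2 * s1 l) := by
  refine ⟨100 * (l : ℝ) + 8 / b₁ + 8 / b₂, ?_⟩
  intro k hk hk1 a₁ a₂ ha₁l ha₁u ha₂l ha₂u b hb hd
  have hk0 : 0 < k := by linarith
  have h8₁ : 0 < 8 / b₁ := by positivity
  have h8₂ : 0 < 8 / b₂ := by positivity
  have hl6 : (6 : ℝ) ≤ l := by exact_mod_cast hl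
  have hs1 : 0 ≤ s1 l := by unfold s1; linarith
  have hks : 1 ≤ k ^ s1 l := Real.one_le_rpow hk1.le hs1
  have hbk₁ : 8 ≤ k * b₁ := (div_le_iff₀ hb₁).mp (by linarith)
  have hbk₂ : 8 ≤ k * b₂ := (div_le_iff₀ hb₂).mp (by linarith)
  have hba₁ : b₁ / 4 ≤ a₁ := by nlinarith
  have hba₂ : b₂ / 4 ≤ a₂ := by nlinarith
  have ha₁ : 0 < a₁ := by linarith
  have ha₂ : 0 < a₂ := by linarith
  obtain ⟨hb1, hb2, hb3, hb4⟩ := id hb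
  obtain ⟨F₁, hF₁, hc₁⟩ := exists_finset_int (k := k) ha₁ (by nlinarith) hb1 hb2
  obtain ⟨F₂, hF₂, hc₂⟩ := exists_finset_int (k := k) ha₂ (by nlinarith) hb3 hb4
  have hroots := fun m : ℤ × ℤ =>
    finite_ncard_nsq_eq_le hk0 b (pvec a₁ a₂ m) (add_pvec_ne_zero ha₁ ha₂ hb hd m)
  let R : ℤ × ℤ → Finset ℂ := fun m => (hroots m).1.toFinset
  have hR : ∀ m, (R m).card ≤ 2 := fun m => by
    rw [← Set.ncard_eq_toFinset_card _ (hroots m).1]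
    exact (hroots m).2
  classical
  have hsub : {φ ∈ Phi0 l k | ∃ m : ℤ × ℤ,
      nsq (y0 k b φ + cx (pvec a₁ a₂ m)) ^ l = (k : ℂ) ^ (2 * l)} ⊆
      (((F₁ ×ˢ F₂).biUnion R : Finset ℂ) : Set ℂ) := by
    rintro φ ⟨hφ, m, hm⟩
    obtain ⟨hroot, hsq⟩ := nsq_eq_of_nsq_pow_eq hl hk0 b (pvec a₁ a₂ m)
      (l_mul_abs_sinh_le hl hk1 (by linarith) hφ) hm
    rw [Finset.mem_coe, Finset.mem_biUnion]
    refine ⟨m, Finset.mem_product.mpr ⟨hF₁ _ ?_, hF₂ _ ?_⟩, ?_⟩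
    · exact abs_le_of_sq_le_sq (by simp only [pvec] at hsq; nlinarith) (by positivity)
    · exact abs_le_of_sq_le_sq (by simp only [pvec] at hsq; nlinarith) (by positivity)
    · exact (hroots m).1.mem_toFinset.mpr ⟨hφ.1, hroot⟩
  refine ⟨(Finset.finite_toSet _).subset hsub, ?_⟩
  have hcard : ({φ ∈ Phi0 l k | ∃ m : ℤ × ℤ,
      nsq (y0 k b φ + cx (pvec a₁ a₂ m)) ^ l = (k : ℂ) ^ (2 * l)}.ncard : ℝ) ≤
      F₁.card * F₂.card * 2 := by
    have h1 := Set.ncard_le_ncard hsub (Finset.finite_toSet _)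
    rw [Set.ncard_coe_finset] at h1
    have h2 := h1.trans (Finset.card_biUnion_le_card_mul _ R 2 fun m _ => hR m)
    rw [Finset.card_product] at h2
    exact_mod_cast h2
  have hpow : k ^ (2 + 2 * s1 l) = k ^ 2 * (k ^ s1 l * k ^ s1 l) := by
    rw [Real.rpow_add hk0, two_mul, Real.rpow_add hk0, Real.rpow_two]
  calc _ ≤ (F₁.card : ℝ) * F₂.card * 2 := hcard
    _ ≤ (4 * (k * (k ^ s1 l * b₁))) * (4 * (k * (k ^ s1 l * b₂))) * 2 := by
      gcongr
      · exact hc₁.trans (by gcongr)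
      · exact hc₂.trans (by gcongr)
    _ = _ := by rw [hpow]; ring
end
end
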